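/- arXiv:2210.15174 — 6 statements merged into one kernel-verified Lean document; each statement's English description precedes it below -/
import Mathlib

section
/- Let p be a prime, n a positive integer, and ζ a primitive p^n-th root of unity in ℂ. Let c_0, c_1, …, c_{p^n−1} be integers. Then ∑_{i=0}^{p^n−1} c_i ζ^i = 0 if and only if c_i = c_j for all indices i, j ∈ {0, …, p^n−1} with i ≡ j (mod p^{n−1}). -/
open Finset Polynomial

theorem coeff_geom_sum_X_pow_mul {R : Type*} [Semiring R] {q : ℕ} (hq : 0 < q) (p : ℕ) {g : R[X]}
    (hg : ∀ i, q ≤ i → g.coeff i = 0) {i : ℕ} (hi : i < q * p) :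
    ((∑ k ∈ range p, (X ^ q) ^ k) * g).coeff i = g.coeff (i % q) := by
  have hdiv : i / q < p := Nat.div_lt_of_lt_mul hi
  have hmod := Nat.div_add_mod i q
  simp only [sum_mul, finsetSum_coeff, ← pow_mul, coeff_X_pow_mul']
  rw [sum_eq_single_of_mem (i / q) (mem_range.2 hdiv)]
  · rw [if_pos (Nat.mul_div_le i q), ← Nat.mod_eq_sub_mul_div]
  · intro k _ hk
    split_ifs with h
    · apply hg
      have hkq : k < i / q := by
        refine lt_of_le_of_ne ?_ hk
        rw [Nat.le_div_iff_mul_le hq, mul_comm]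
        exact h
      have := Nat.mul_le_mul_left q (Nat.succ_le_of_lt hkq)
      rw [Nat.mul_succ] at this
      omega
    · rfl

theorem sum_primitive_root_pow_eq_zero_iff (p n : ℕ) (hp : p.Prime) (hn : 0 < n)
    (ζ : ℂ) (hζ : IsPrimitiveRoot ζ (p ^ n)) (c : ℕ → ℤ) :
    (∑ i ∈ Finset.range (p ^ n), (c i : ℂ) * ζ ^ i = 0) ↔
      ∀ i ∈ Finset.range (p ^ n), ∀ j ∈ Finset.range (p ^ n),
        i % p ^ (n - 1) = j % p ^ (n - 1) → c i = c j := by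
  obtain ⟨m, rfl⟩ : ∃ m, n = m + 1 := ⟨n - 1, by omega⟩
  have hpos : 0 < p ^ (m + 1) := pow_pos hp.pos _
  have hq : 0 < p ^ m := pow_pos hp.pos _
  have hle : p ^ m ≤ p ^ (m + 1) := Nat.pow_le_pow_right hp.pos m.le_succ
  have hcoeff (N : ℕ) (i : ℕ) :
      (∑ i ∈ range N, C (c i) * X ^ i).coeff i = if i < N then c i else 0 := by
    simp [coeff_X_pow]
  set f : ℤ[X] := ∑ i ∈ range (p ^ (m + 1)), C (c i) * X ^ i with hf
  have hΦ := cyclotomic_prime_pow_eq_geom_sum (R := ℤ) (n := m) hp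
  have hdegΦ : (cyclotomic (p ^ (m + 1)) ℤ).natDegree + p ^ m = p ^ (m + 1) := by
    rw [natDegree_cyclotomic, Nat.totient_prime_pow_succ hp, ← Nat.mul_succ, pow_succ,
      Nat.succ_eq_add_one, Nat.sub_add_cancel hp.one_le]
  have hdvd : (∑ i ∈ range (p ^ (m + 1)), (c i : ℂ) * ζ ^ i = 0) ↔
      cyclotomic (p ^ (m + 1)) ℤ ∣ f := by
    rw [cyclotomic_eq_minpoly hζ hpos,
      ← minpoly.isIntegrallyClosed_dvd_iff (hζ.isIntegral hpos)]
    simp [hf]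
  rw [hdvd]
  simp only [mem_range, Nat.add_sub_cancel]
  constructor
  · rintro ⟨g, hg⟩
    have hg0 : ∀ i, p ^ m ≤ i → g.coeff i = 0 := by
      intro i hi
      by_cases h0 : g = 0
      · simp [h0]
      apply coeff_eq_zero_of_natDegree_lt
      have hdeg := (cyclotomic.monic (p ^ (m + 1)) ℤ).natDegree_mul' h0
      have hflt : f.natDegree < p ^ (m + 1) := by
        rw [natDegree_lt_iff_degree_lt (hg ▸ mul_ne_zero (cyclotomic_ne_zero _ _) h0),
          degree_lt_iff_coeff_zero]
        intro k hk
        rw [hcoeff, if_neg hk.not_gt]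
      rw [← hg] at hdeg
      omega
    have key : ∀ i < p ^ (m + 1), c i = g.coeff (i % p ^ m) := by
      intro i hi
      rw [← coeff_geom_sum_X_pow_mul hq p hg0 (by rwa [← pow_succ]), ← hΦ, ← hg, hcoeff, if_pos hi]
    intro i hi j hj hij
    rw [key i hi, key j hj, hij]
  · intro h
    set g : ℤ[X] := ∑ i ∈ range (p ^ m), C (c i) * X ^ i
    have hg0 : ∀ i, p ^ m ≤ i → g.coeff i = 0 := fun i hi => by
      rw [hcoeff, if_neg hi.not_gt]
    refine ⟨g, ?_⟩
    ext i
    by_cases hi : i < p ^ (m + 1)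
    · have hmod := Nat.mod_lt i hq
      rw [hΦ, coeff_geom_sum_X_pow_mul hq p hg0 (by rwa [← pow_succ]), hcoeff, hcoeff, if_pos hi,
        if_pos hmod]
      exact h _ hi _ (hmod.trans_le hle) (Nat.mod_mod _ _).symm
    · rw [hcoeff, if_neg hi, coeff_eq_zero_of_natDegree_lt]
      have hglt : g.natDegree < p ^ m := by
        by_cases h0 : g = 0
        · simpa [h0] using hq
        rw [natDegree_lt_iff_degree_lt h0, degree_lt_iff_coeff_zero]
        exact hg0
      have := natDegree_mul_le (p := cyclotomic (p ^ (m + 1)) ℤ) (q := g)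
      omega
end

section
/- Let A ⊆ G = Z_{p^n} × Z_q × Z_r and let i be an integer with 0 ≤ i ≤ n. Then χ_{(p^i,1,1)}(A) = 0 if and only if for all j ∈ {0,…,q−1} and k ∈ {0,…,r−1} one has χ_{p^i,p^n}(A_{jk}) − χ_{p^i,p^n}(A_{j0}) − χ_{p^i,p^n}(A_{0k}) + χ_{p^i,p^n}(A_{00}) = 0. -/
open Finset

/-- `chiX M m X = ∑_{x ∈ X} e^{2πi·m·x/M}`. -/
noncomputable def chiX (M : ℕ) (m : ℕ) (X : Finset (ZMod M)) : ℂ :=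
  ∑ x ∈ X, Complex.exp (2 * Real.pi * Complex.I * m * x.val / M)

/-- The fiber `A_{jk} = {x ∈ Z_{p^n} : (x, j, k) ∈ A}`. -/
def fiber (p q r n : ℕ) (A : Finset (ZMod (p ^ n) × ZMod q × ZMod r)) (j k : ℕ) :
    Finset (ZMod (p ^ n)) :=
  (A.filter fun g => g.2.1 = (j : ZMod q) ∧ g.2.2 = (k : ZMod r)).image Prod.fst

/-- `chiG p q r n m s t A = ∑_{(x,j,k) ∈ A} e^{2πi(m·x/p^n + s·j/q + t·k/r)}`. -/
noncomputable def chiG (p q r n : ℕ) (m s t : ℕ)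
    (A : Finset (ZMod (p ^ n) × ZMod q × ZMod r)) : ℂ :=
  ∑ g ∈ A, Complex.exp (2 * Real.pi * Complex.I *
    (m * g.1.val / (p ^ n : ℕ) + s * g.2.1.val / q + t * g.2.2.val / r))

open IntermediateField

/-- A primitive root of unity of prime order `q` has full degree over `ℚ(ζ_N)` when `q ∤ N`. -/
lemma le_natDegree_minpoly_of_coprime {L : Type*} [Field L] [CharZero L] {N q : ℕ} {ζ ω : L}
    (hN : 0 < N) (hq : q.Prime) (hNq : N.Coprime q) (hζ : IsPrimitiveRoot ζ N)
    (hω : IsPrimitiveRoot ω q) : q - 1 ≤ (minpoly ℚ⟮ζ⟯ ω).natDegree := by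
  have hζint : IsIntegral ℚ ζ := (hζ.isIntegral hN).tower_top (R := ℤ)
  have hωint : IsIntegral ℚ⟮ζ⟯ ω := (hω.isIntegral hq.pos).tower_top
  have := adjoin.finiteDimensional hζint
  have := adjoin.finiteDimensional hωint
  have hK : Module.finrank ℚ ℚ⟮ζ⟯ = N.totient := by
    rw [adjoin.finrank hζint, ← Polynomial.cyclotomic_eq_minpoly_rat hζ hN,
      Polynomial.natDegree_cyclotomic]
  have hF : Module.finrank ℚ⟮ζ⟯ ℚ⟮ζ⟯⟮ω⟯ = (minpoly ℚ⟮ζ⟯ ω).natDegree := adjoin.finrank hωint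
  have hmul := Module.finrank_mul_finrank ℚ ℚ⟮ζ⟯ ℚ⟮ζ⟯⟮ω⟯
  have : FiniteDimensional ℚ ℚ⟮ζ⟯⟮ω⟯ := FiniteDimensional.trans ℚ ℚ⟮ζ⟯ _
  let x : ℚ⟮ζ⟯⟮ω⟯ := algebraMap ℚ⟮ζ⟯ ℚ⟮ζ⟯⟮ω⟯ (AdjoinSimple.gen ℚ ζ)
  let y : ℚ⟮ζ⟯⟮ω⟯ := AdjoinSimple.gen ℚ⟮ζ⟯ ω
  have hx : IsPrimitiveRoot x N :=
    .of_map_of_injective (f := algebraMap ℚ⟮ζ⟯⟮ω⟯ L) (by exact hζ)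
      (FaithfulSMul.algebraMap_injective _ _)
  have hy : IsPrimitiveRoot y q :=
    .of_map_of_injective (f := algebraMap ℚ⟮ζ⟯⟮ω⟯ L) (by exact hω)
      (FaithfulSMul.algebraMap_injective _ _)
  have hle := hx.lcm_totient_le_finrank hy
    (Polynomial.cyclotomic.irreducible_rat (Nat.lcm_pos hN hq.pos))
  rw [hNq.lcm_eq_mul, Nat.totient_mul hNq, Nat.totient_prime hq, ← hmul, hK, hF] at hle
  exact Nat.le_of_mul_le_mul_left hle (Nat.totient_pos.2 hN)

/-- For `q` prime with `q ∤ N`, the only `ℚ(ζ_N)`-linear relations between the `q`-th roots of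
unity are the multiples of `1 + ω + ⋯ + ω ^ (q - 1) = 0`. -/
lemma sum_mul_pow_eq_zero_iff {L : Type*} [Field L] [CharZero L] {N q : ℕ} {ζ ω : L}
    (hN : 0 < N) (hq : q.Prime) (hNq : N.Coprime q) (hζ : IsPrimitiveRoot ζ N)
    (hω : IsPrimitiveRoot ω q) (a : ℕ → L) (ha : ∀ j, a j ∈ ℚ⟮ζ⟯) :
    ∑ j ∈ range q, a j * ω ^ j = 0 ↔ ∀ j < q, a j = a 0 := by
  have hgeom : ∑ j ∈ range q, ω ^ j = 0 := hω.geom_sum_eq_zero hq.one_lt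
  refine ⟨fun h => ?_, fun h => ?_⟩
  · obtain ⟨m, rfl⟩ : ∃ m, q = m + 1 := ⟨q - 1, by have := hq.pos; omega⟩
    have hm : m ≤ (minpoly ℚ⟮ζ⟯ ω).natDegree :=
      le_natDegree_minpoly_of_coprime hN hq hNq hζ hω
    have hli := (linearIndependent_pow (K := ℚ⟮ζ⟯) ω).comp (Fin.castLE hm)
      (Fin.castLE_injective hm)
    have hsum : ∑ j ∈ range m, (a j - a m) * ω ^ j = 0 := by
      have : ∑ j ∈ range (m + 1), (a j - a m) * ω ^ j = 0 := by
        simp only [sub_mul, sum_sub_distrib, ← mul_sum, h, hgeom, mul_zero, sub_zero]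
      simpa [sum_range_succ] using this
    have hzero := Fintype.linearIndependent_iff.1 hli
      (fun j => ⟨a j - a m, sub_mem (ha j) (ha m)⟩) (by
        rw [← hsum, ← Fin.sum_univ_eq_sum_range fun j => (a j - a m) * ω ^ j]
        rfl)
    have hlast : ∀ j < m + 1, a j = a m := fun j hj => by
      rcases Nat.lt_succ_iff_lt_or_eq.1 hj with hj | rfl
      · exact sub_eq_zero.1 (congrArg Subtype.val (hzero ⟨j, hj⟩))
      · rfl
    exact fun j hj => (hlast j hj).trans (hlast 0 m.succ_pos).symm
  · rw [sum_congr rfl fun j hj => by rw [h j (mem_range.1 hj)], ← mul_sum, hgeom, mul_zero]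

lemma chiX_mem_adjoin (M m : ℕ) (X : Finset (ZMod M)) :
    chiX M m X ∈ ℚ⟮Complex.exp (2 * Real.pi * Complex.I / M)⟯ := by
  refine sum_mem fun x _ => ?_
  have : Complex.exp (2 * Real.pi * Complex.I * m * x.val / M)
      = Complex.exp (2 * Real.pi * Complex.I / M) ^ (m * x.val) := by
    rw [← Complex.exp_nat_mul]
    congr 1
    push_cast
    ring
  rw [this]
  exact pow_mem (mem_adjoin_simple_self ℚ _) _

lemma chiX_fiber {p q r n : ℕ} (m : ℕ) (A : Finset (ZMod (p ^ n) × ZMod q × ZMod r)) (j k : ℕ) :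
    chiX (p ^ n) m (fiber p q r n A j k)
      = ∑ g ∈ A with g.2.1 = (j : ZMod q) ∧ g.2.2 = (k : ZMod r),
          Complex.exp (2 * Real.pi * Complex.I * m * g.1.val / (p ^ n : ℕ)) := by
  rw [chiX, fiber, sum_image]
  rintro ⟨x, y, z⟩ h ⟨x', y', z'⟩ h' hx
  simp only [coe_filter, Set.mem_ofPred_eq] at h h' hx
  rw [hx, h.2.1, h.2.2, h'.2.1, h'.2.2]

lemma ZMod.val_eq_iff_eq_natCast {q j : ℕ} [NeZero q] (hj : j < q) (y : ZMod q) :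
    y.val = j ↔ y = j :=
  ⟨fun h => by rw [← h, ZMod.natCast_zmod_val], fun h => by rw [h, ZMod.val_cast_of_lt hj]⟩

lemma chiG_one_one_eq_sum_chiX {p q r n : ℕ} [NeZero q] [NeZero r] (m : ℕ)
    (A : Finset (ZMod (p ^ n) × ZMod q × ZMod r)) :
    chiG p q r n m 1 1 A
      = ∑ k ∈ range r, (∑ j ∈ range q, chiX (p ^ n) m (fiber p q r n A j k)
          * Complex.exp (2 * Real.pi * Complex.I / q) ^ j)
          * Complex.exp (2 * Real.pi * Complex.I / r) ^ k := by
  rw [chiG, ← sum_fiberwise_of_maps_to (t := range r) (g := fun g => g.2.2.val)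
    fun g _ => mem_range.2 (ZMod.val_lt _)]
  refine sum_congr rfl fun k hk => ?_
  rw [← sum_fiberwise_of_maps_to (t := range q) (g := fun g => g.2.1.val)
    fun g _ => mem_range.2 (ZMod.val_lt _), sum_mul]
  refine sum_congr rfl fun j hj => ?_
  rw [chiX_fiber, sum_mul, sum_mul, filter_filter]
  refine sum_congr (filter_congr fun g _ => ?_) fun g hg => ?_
  · rw [ZMod.val_eq_iff_eq_natCast (mem_range.1 hk), ZMod.val_eq_iff_eq_natCast (mem_range.1 hj),
      and_comm]
  · obtain ⟨-, hgj, hgk⟩ := mem_filter.1 hg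
    rw [(ZMod.val_eq_iff_eq_natCast (mem_range.1 hk) _).2 hgk,
      (ZMod.val_eq_iff_eq_natCast (mem_range.1 hj) _).2 hgj, ← Complex.exp_nat_mul,
      ← Complex.exp_nat_mul, ← Complex.exp_add, ← Complex.exp_add]
    congr 1
    push_cast
    ring

lemma exp_mem_adjoin_exp_of_mul {M d : ℕ} (hd : d ≠ 0) :
    Complex.exp (2 * Real.pi * Complex.I / M)
      ∈ ℚ⟮Complex.exp (2 * Real.pi * Complex.I / (M * d : ℕ))⟯ := by
  have : Complex.exp (2 * Real.pi * Complex.I / M)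
      = Complex.exp (2 * Real.pi * Complex.I / (M * d : ℕ)) ^ d := by
    rw [← Complex.exp_nat_mul]
    congr 1
    push_cast
    have : (d : ℂ) ≠ 0 := Nat.cast_ne_zero.2 hd
    field_simp
  rw [this]
  exact pow_mem (mem_adjoin_simple_self ℚ _) _

theorem zero_iff_fiber_relation_1_1 (p q r n : ℕ) (hp : p.Prime) (hq : q.Prime)
    (hr : r.Prime) (hpq : p ≠ q) (hpr : p ≠ r) (hqr : q ≠ r) (hn : 0 < n)
    (A : Finset (ZMod (p ^ n) × ZMod q × ZMod r)) (i : ℕ) (hi : i ≤ n) :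
    chiG p q r n (p ^ i) 1 1 A = 0 ↔
      ∀ j < q, ∀ k < r,
        chiX (p ^ n) (p ^ i) (fiber p q r n A j k)
          - chiX (p ^ n) (p ^ i) (fiber p q r n A j 0)
          - chiX (p ^ n) (p ^ i) (fiber p q r n A 0 k)
          + chiX (p ^ n) (p ^ i) (fiber p q r n A 0 0) = 0 := by
  have : NeZero q := ⟨hq.ne_zero⟩
  have : NeZero r := ⟨hr.ne_zero⟩
  have hM : 0 < p ^ n := pow_pos hp.pos n
  have hMq : (p ^ n).Coprime q := ((Nat.coprime_primes hp hq).2 hpq).pow_left n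
  have hMqr : (p ^ n * q).Coprime r :=
    (((Nat.coprime_primes hp hr).2 hpr).pow_left n).mul_left ((Nat.coprime_primes hq hr).2 hqr)
  set c : ℕ → ℕ → ℂ := fun j k => chiX (p ^ n) (p ^ i) (fiber p q r n A j k)
  have hc (j k : ℕ) : c j k ∈ ℚ⟮Complex.exp (2 * Real.pi * Complex.I / (p ^ n : ℕ))⟯ :=
    chiX_mem_adjoin _ _ _
  have hω : Complex.exp (2 * Real.pi * Complex.I / q)
      ∈ ℚ⟮Complex.exp (2 * Real.pi * Complex.I / (p ^ n * q : ℕ))⟯ := by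
    rw [mul_comm (p ^ n) q]
    exact exp_mem_adjoin_exp_of_mul hM.ne'
  have hsub : ℚ⟮Complex.exp (2 * Real.pi * Complex.I / (p ^ n : ℕ))⟯
      ≤ ℚ⟮Complex.exp (2 * Real.pi * Complex.I / (p ^ n * q : ℕ))⟯ :=
    adjoin_simple_le_iff.2 (exp_mem_adjoin_exp_of_mul hq.ne_zero)
  have hrow (k : ℕ) :
      ∑ j ∈ range q, c j k * Complex.exp (2 * Real.pi * Complex.I / q) ^ j
          = ∑ j ∈ range q, c j 0 * Complex.exp (2 * Real.pi * Complex.I / q) ^ j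
        ↔ ∀ j < q, c j k - c j 0 = c 0 k - c 0 0 := by
    rw [← sub_eq_zero, ← sum_sub_distrib]
    simp only [← sub_mul]
    exact sum_mul_pow_eq_zero_iff hM hq hMq (Complex.isPrimitiveRoot_exp _ hM.ne')
      (Complex.isPrimitiveRoot_exp q hq.ne_zero) (fun j => c j k - c j 0)
      fun j => sub_mem (hc j k) (hc j 0)
  rw [chiG_one_one_eq_sum_chiX, sum_mul_pow_eq_zero_iff (Nat.mul_pos hM hq.pos) hr hMqr
    (Complex.isPrimitiveRoot_exp _ (Nat.mul_pos hM hq.pos).ne')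
    (Complex.isPrimitiveRoot_exp r hr.ne_zero) _
    fun k => sum_mem fun j _ => mul_mem (hsub (hc j k)) (pow_mem hω j)]
  refine (forall₂_congr fun k _ => hrow k).trans ⟨fun h j hj k hk => ?_, fun h k hk j hj => ?_⟩
  · linear_combination h k hk j hj
  · linear_combination h j hj k hk
end

section
/- Let A ⊆ G = Z_{p^n} × Z_q × Z_r and let i be an integer with 0 ≤ i ≤ n. If χ_{(p^i,0,1)}(A) = 0 and χ_{(p^i,1,0)}(A) = 0, then for all j ∈ {0,…,q−1} and k ∈ {0,…,r−1} one has r·∑_{j'=0}^{q−1} χ_{p^i,p^n}(A_{j'k}) = q·∑_{k'=0}^{r−1} χ_{p^i,p^n}(A_{jk'}). -/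
open Finset

open Polynomial in
/-- The Galois conjugation fixing the `M`-th roots of unity and raising the `r`-th roots of unity to
the power `t` preserves vanishing sums. -/
theorem sum_pow_mul_pow_conj_eq_zero {ι : Type*} {M r : ℕ} (hM : 0 < M) (hr : 0 < r)
    (hMr : M.Coprime r) {η ω : ℂ} (hη : IsPrimitiveRoot η M) (hω : IsPrimitiveRoot ω r)
    (s : Finset ι) (e f : ι → ℕ) (h : ∑ g ∈ s, η ^ e g * ω ^ f g = 0) {t : ℕ}
    (ht : t.Coprime r) : ∑ g ∈ s, η ^ e g * (ω ^ t) ^ f g = 0 := by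
  obtain ⟨u, huM, hur⟩ := Nat.chineseRemainder hMr 1 0
  obtain ⟨v, hvM, hvr⟩ := Nat.chineseRemainder hMr 0 1
  have key : ∀ ξ : ℂ, IsPrimitiveRoot ξ r →
      aeval (η * ξ) (∑ g ∈ s, (X : ℤ[X]) ^ (u * e g + v * f g)) =
        ∑ g ∈ s, η ^ e g * ξ ^ f g := by
    intro ξ hξ
    have hu : (η * ξ) ^ u = η := by
      rw [mul_pow, pow_eq_pow_mod u hξ.pow_eq_one, hur, pow_eq_pow_mod u hη.pow_eq_one, huM,
        ← pow_eq_pow_mod 1 hη.pow_eq_one]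
      simp
    have hv : (η * ξ) ^ v = ξ := by
      rw [mul_pow, pow_eq_pow_mod v hξ.pow_eq_one, hvr, pow_eq_pow_mod v hη.pow_eq_one, hvM,
        ← pow_eq_pow_mod 1 hξ.pow_eq_one]
      simp
    simp [pow_add, pow_mul, hu, hv]
  have prim : ∀ ξ : ℂ, IsPrimitiveRoot ξ r → IsPrimitiveRoot (η * ξ) (M * r) := by
    intro ξ hξ
    have := (Commute.all η ξ).orderOf_mul_eq_mul_orderOf_of_coprime
      (by rwa [← hη.eq_orderOf, ← hξ.eq_orderOf])
    rw [← hη.eq_orderOf, ← hξ.eq_orderOf] at this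
    exact this ▸ IsPrimitiveRoot.orderOf _
  have hω' : IsPrimitiveRoot (ω ^ t) r := hω.pow_of_coprime t ht
  have hN : 0 < M * r := Nat.mul_pos hM hr
  rw [← key ω hω] at h
  rw [← key _ hω']
  have hdvd := minpoly.isIntegrallyClosed_dvd ((prim ω hω).isIntegral hN) h
  rw [← cyclotomic_eq_minpoly (prim ω hω) hN, cyclotomic_eq_minpoly (prim _ hω') hN] at hdvd
  exact aeval_eq_zero_of_dvd_aeval_eq_zero hdvd (minpoly.aeval _ _)

/-- If `∑ η ^ e * ω ^ f` vanishes then all the level sets of `f` contribute equally to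
`∑ η ^ e`. -/
theorem prime_mul_sum_filter_eq_sum {ι : Type*} {M r : ℕ} (hM : 0 < M) (hr : r.Prime)
    (hMr : M.Coprime r) {η ω : ℂ} (hη : IsPrimitiveRoot η M) (hω : IsPrimitiveRoot ω r)
    (s : Finset ι) (e f : ι → ℕ) (hf : ∀ g ∈ s, f g < r)
    (h : ∑ g ∈ s, η ^ e g * ω ^ f g = 0) {k : ℕ} (hk : k < r) :
    (r : ℂ) * ∑ g ∈ s with f g = k, η ^ e g = ∑ g ∈ s, η ^ e g := by
  have hω0 : ω ≠ 0 := hω.ne_zero hr.ne_zero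
  have orth : ∀ g ∈ s, ∑ t ∈ Finset.range r, (ω ^ f g / ω ^ k) ^ t =
      if f g = k then (r : ℂ) else 0 := by
    intro g hg
    split_ifs with hgk
    · simp [hgk, hω0]
    · have hne : ω ^ f g / ω ^ k ≠ 1 := by
        rw [Ne, div_eq_one_iff_eq (pow_ne_zero _ hω0)]
        exact fun h' => hgk (hω.pow_inj (hf g hg) hk h')
      rw [geom_sum_eq hne, div_pow, ← pow_mul, ← pow_mul, mul_comm _ r, mul_comm _ r, pow_mul,
        pow_mul, hω.pow_eq_one]
      simp
  calc (r : ℂ) * ∑ g ∈ s with f g = k, η ^ e g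
      = ∑ g ∈ s, η ^ e g * ∑ t ∈ Finset.range r, (ω ^ f g / ω ^ k) ^ t := by
        rw [Finset.sum_filter, Finset.mul_sum]
        refine Finset.sum_congr rfl fun g hg => ?_
        rw [orth g hg]
        split_ifs <;> ring
    _ = ∑ t ∈ Finset.range r, (∑ g ∈ s, η ^ e g * (ω ^ t) ^ f g) / (ω ^ k) ^ t := by
        simp_rw [Finset.mul_sum, Finset.sum_div]
        rw [Finset.sum_comm]
        refine Finset.sum_congr rfl fun t _ => Finset.sum_congr rfl fun g _ => ?_
        rw [div_pow, pow_right_comm ω t, mul_div_assoc]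
    _ = ∑ g ∈ s, η ^ e g := by
        rw [Finset.sum_eq_single_of_mem 0 (Finset.mem_range.2 hr.pos)]
        · simp
        · intro t ht ht0
          have hcop : t.Coprime r :=
            (hr.coprime_iff_not_dvd.2 (Nat.not_dvd_of_pos_of_lt (Nat.pos_of_ne_zero ht0)
            (Finset.mem_range.1 ht))).symm
          rw [sum_pow_mul_pow_conj_eq_zero hM hr.pos hMr hη hω s e f h hcop, zero_div]

theorem exp_two_pi_mul_div_eq_pow (M a : ℕ) :
    Complex.exp (2 * Real.pi * Complex.I * (a / M)) =
      Complex.exp (2 * Real.pi * Complex.I / M) ^ a := by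
  rw [← Complex.exp_nat_mul]
  ring_nf

theorem chiX_fiber_eq_sum (p q r n m : ℕ) [NeZero q] [NeZero r]
    (A : Finset (ZMod (p ^ n) × ZMod q × ZMod r)) {j k : ℕ} (hj : j < q) (hk : k < r) :
    chiX (p ^ n) m (fiber p q r n A j k) = ∑ g ∈ A with g.2.1.val = j ∧ g.2.2.val = k,
      Complex.exp (2 * Real.pi * Complex.I / (p ^ n : ℕ)) ^ (m * g.1.val) := by
  have hiff : ∀ {N a : ℕ} [NeZero N] (x : ZMod N), a < N → (x = (a : ZMod N) ↔ x.val = a) :=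
    fun x ha => ⟨fun h => by rw [h, ZMod.val_cast_of_lt ha], fun h => by rw [← h]; simp⟩
  rw [chiX, fiber, Finset.sum_image]
  · simp_rw [hiff _ hj, hiff _ hk]
    refine Finset.sum_congr rfl fun g _ => ?_
    rw [← exp_two_pi_mul_div_eq_pow]
    push_cast
    ring_nf
  · rintro ⟨x, y, z⟩ hg ⟨x', y', z'⟩ hg' h
    simp only [Finset.coe_filter, Set.mem_ofPred_eq] at hg hg'
    simp only at h
    rw [h, hg.2.1, hg.2.2, hg'.2.1, hg'.2.2]

theorem row_col_sum_relation (p q r n : ℕ) (hp : p.Prime) (hq : q.Prime)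
    (hr : r.Prime) (hpq : p ≠ q) (hpr : p ≠ r) (hqr : q ≠ r) (hn : 0 < n)
    (A : Finset (ZMod (p ^ n) × ZMod q × ZMod r)) (i : ℕ) (hi : i ≤ n)
    (h1 : chiG p q r n (p ^ i) 0 1 A = 0)
    (h2 : chiG p q r n (p ^ i) 1 0 A = 0) :
    ∀ j < q, ∀ k < r,
      (r : ℂ) * ∑ j' ∈ Finset.range q, chiX (p ^ n) (p ^ i) (fiber p q r n A j' k) =
        (q : ℂ) * ∑ k' ∈ Finset.range r, chiX (p ^ n) (p ^ i) (fiber p q r n A j k') := by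
  have := NeZero.mk hq.ne_zero
  have := NeZero.mk hr.ne_zero
  intro j hj k hk
  have hM : 0 < p ^ n := pow_pos hp.pos n
  have hη := Complex.isPrimitiveRoot_exp (p ^ n) hM.ne'
  have hωq := Complex.isPrimitiveRoot_exp q hq.ne_zero
  have hωr := Complex.isPrimitiveRoot_exp r hr.ne_zero
  have hcq : (p ^ n).Coprime q := ((Nat.coprime_primes hp hq).2 hpq).pow_left n
  have hcr : (p ^ n).Coprime r := ((Nat.coprime_primes hp hr).2 hpr).pow_left n
  have h1' : ∑ g ∈ A, Complex.exp (2 * Real.pi * Complex.I / (p ^ n : ℕ)) ^ (p ^ i * g.1.val) *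
      Complex.exp (2 * Real.pi * Complex.I / r) ^ g.2.2.val = 0 := by
    rw [← h1, chiG]
    refine Finset.sum_congr rfl fun g _ => ?_
    rw [← exp_two_pi_mul_div_eq_pow, ← exp_two_pi_mul_div_eq_pow, ← Complex.exp_add]
    push_cast
    ring_nf
  have h2' : ∑ g ∈ A, Complex.exp (2 * Real.pi * Complex.I / (p ^ n : ℕ)) ^ (p ^ i * g.1.val) *
      Complex.exp (2 * Real.pi * Complex.I / q) ^ g.2.1.val = 0 := by
    rw [← h2, chiG]
    refine Finset.sum_congr rfl fun g _ => ?_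
    rw [← exp_two_pi_mul_div_eq_pow, ← exp_two_pi_mul_div_eq_pow, ← Complex.exp_add]
    push_cast
    ring_nf
  have hcol := prime_mul_sum_filter_eq_sum hM hr hcr hη hωr A _ _
    (fun g _ => ZMod.val_lt g.2.2) h1' hk
  have hrow := prime_mul_sum_filter_eq_sum hM hq hcq hη hωq A _ _
    (fun g _ => ZMod.val_lt g.2.1) h2' hj
  rw [Finset.sum_congr rfl fun j' hj' =>
      chiX_fiber_eq_sum p q r n (p ^ i) A (Finset.mem_range.1 hj') hk,
    Finset.sum_congr rfl fun k' hk' =>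
      chiX_fiber_eq_sum p q r n (p ^ i) A hj (Finset.mem_range.1 hk')]
  rw [← Finset.sum_fiberwise_of_maps_to (s := A.filter _) (t := Finset.range q)
    (g := fun g => g.2.1.val) fun g _ => Finset.mem_range.2 (ZMod.val_lt g.2.1)] at hcol
  rw [← Finset.sum_fiberwise_of_maps_to (s := A.filter _) (t := Finset.range r)
    (g := fun g => g.2.2.val) fun g _ => Finset.mem_range.2 (ZMod.val_lt g.2.2)] at hrow
  simp_rw [Finset.filter_filter] at hcol hrow
  simp_rw [and_comm (a := _ = k)] at hcol
  rw [hcol, hrow]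
end

section
/- Let A ⊆ G = Z_{p^n} × Z_q × Z_r and let i be an integer with 0 ≤ i ≤ n. If χ_{(p^i,1,1)}(A) = 0, χ_{(p^i,0,1)}(A) = 0 and χ_{(p^i,1,0)}(A) = 0, then χ_{p^i,p^n}(A_{jk}) = χ_{p^i,p^n}(A_{00}) for all j ∈ {0,…,q−1} and k ∈ {0,…,r−1}. -/
open Finset

open IntermediateField Polynomial in
/-- A primitive `m`-th root of unity has degree at least `φ(m)` over the field generated by a
primitive `N`-th root of unity, when `N` and `m` are coprime. -/
lemma IsPrimitiveRoot.totient_le_natDegree_minpoly_adjoin {K : Type*} [Field K] [CharZero K]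
    {N m : ℕ} (hN : 0 < N) (hm : 0 < m) (hc : N.Coprime m) {ω ζ : K}
    (hω : IsPrimitiveRoot ω N) (hζ : IsPrimitiveRoot ζ m) :
    m.totient ≤ (minpoly ℚ⟮ω⟯ ζ).natDegree := by
  have hωi : IsIntegral ℚ ω := (hω.isIntegral hN).tower_top
  have hζi : IsIntegral ℚ⟮ω⟯ ζ := (hζ.isIntegral hm).tower_top
  have : FiniteDimensional ℚ ℚ⟮ω⟯ := adjoin.finiteDimensional hωi
  have : FiniteDimensional ℚ⟮ω⟯ ℚ⟮ω⟯⟮ζ⟯ := adjoin.finiteDimensional hζi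
  have : FiniteDimensional ℚ ℚ⟮ω⟯⟮ζ⟯ := FiniteDimensional.trans ℚ ℚ⟮ω⟯ ℚ⟮ω⟯⟮ζ⟯
  have htower := Module.finrank_mul_finrank ℚ ℚ⟮ω⟯ ℚ⟮ω⟯⟮ζ⟯
  have hω' : IsPrimitiveRoot (algebraMap ℚ⟮ω⟯ ℚ⟮ω⟯⟮ζ⟯ (AdjoinSimple.gen ℚ ω)) N :=
    IsPrimitiveRoot.of_map_of_injective (f := algebraMap ℚ⟮ω⟯⟮ζ⟯ K)
      (by simpa using hω) (algebraMap ℚ⟮ω⟯⟮ζ⟯ K).injective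
  have hζ' : IsPrimitiveRoot (AdjoinSimple.gen ℚ⟮ω⟯ ζ) m :=
    IsPrimitiveRoot.of_map_of_injective (f := algebraMap ℚ⟮ω⟯⟮ζ⟯ K)
      (by simpa using hζ) (algebraMap ℚ⟮ω⟯⟮ζ⟯ K).injective
  have h := hω'.lcm_totient_le_finrank hζ'
    (cyclotomic.irreducible_rat (Nat.lcm_pos hN hm))
  rw [hc.lcm_eq_mul, Nat.totient_mul hc, ← htower,
    adjoin.finrank hωi, adjoin.finrank hζi, ← cyclotomic_eq_minpoly_rat hω hN,
    natDegree_cyclotomic] at h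
  exact Nat.le_of_mul_le_mul_left h (Nat.totient_pos.2 hN)

open IntermediateField Polynomial in
/-- A vanishing linear combination of the powers `1, ζ, …, ζ ^ (q - 1)` of a primitive `q`-th root
of unity, with coefficients in a cyclotomic field of conductor prime to `q`, is constant. -/
lemma IsPrimitiveRoot.coeff_eq_of_sum_pow_eq_zero {K : Type*} [Field K] [CharZero K]
    {N q : ℕ} {ω ζ : K} (hζ : IsPrimitiveRoot ζ q) (hω : IsPrimitiveRoot ω N)
    (hN : 0 < N) (hq : q.Prime) (hc : N.Coprime q) {b : ℕ → K}
    (hb : ∀ j, b j ∈ ℚ⟮ω⟯) (h : ∑ j ∈ range q, b j * ζ ^ j = 0) {j : ℕ} (hj : j < q) :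
    b j = b 0 := by
  suffices H : ∀ j < q, b j = b (q - 1) by rw [H j hj, H 0 hq.pos]
  intro j hj
  lift b to ℕ → ℚ⟮ω⟯ using hb
  set P : ℚ⟮ω⟯[X] := ∑ j ∈ range (q - 1), C (b j - b (q - 1)) * X ^ j with hP
  have hroot : aeval ζ P = 0 := by
    have hgeom := hζ.geom_sum_eq_zero hq.one_lt
    have key : ∑ j ∈ range q, ((b j : K) - b (q - 1)) * ζ ^ j = 0 := by
      simp only [sub_mul, sum_sub_distrib, ← mul_sum]
      rw [h, hgeom, mul_zero, sub_zero]
    obtain ⟨m, rfl⟩ : ∃ m, q = m + 1 := ⟨q - 1, by have := hq.pos; omega⟩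
    rw [sum_range_succ] at key
    simpa [hP, map_sum] using key
  have hP0 : P = 0 := by
    by_contra hne
    have h1 := minpoly.degree_le_of_ne_zero _ _ hne hroot
    have h2 : P.degree < (q - 1 : ℕ) := by
      rw [hP, degree_lt_iff_coeff_zero]
      intro m hm
      simp only [finsetSum_coeff, coeff_C_mul_X_pow]
      refine sum_eq_zero fun x hx => if_neg ?_
      have := mem_range.1 hx
      omega
    have h4 := hω.totient_le_natDegree_minpoly_adjoin hN hq.pos hc hζ
    rw [Nat.totient_prime hq] at h4
    have h5 := natDegree_le_natDegree h1
    have h6 := (natDegree_lt_iff_degree_lt hne).2 h2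
    omega
  rcases (by omega : j = q - 1 ∨ j < q - 1) with rfl | hj'
  · rfl
  have := congrArg (fun Q => Q.coeff j) hP0
  simp only [hP, finsetSum_coeff, coeff_C_mul_X_pow, coeff_zero] at this
  rw [sum_ite_eq (range (q - 1)) j, if_pos (mem_range.2 hj')] at this
  exact congrArg Subtype.val (sub_eq_zero.1 this)

/-- `chiX` takes values in the field generated by `e^{2πi/M}`. -/
lemma chiX_mem {M : ℕ} {L : IntermediateField ℚ ℂ}
    (hL : Complex.exp (2 * Real.pi * Complex.I / M) ∈ L) (m : ℕ) (X : Finset (ZMod M)) :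
    chiX M m X ∈ L := by
  refine sum_mem fun x _ => ?_
  convert pow_mem hL (m * x.val) using 1
  rw [← Complex.exp_nat_mul]
  congr 1
  push_cast
  ring

/-- A character sum over `A` is the double Fourier sum of the character sums over its fibers. -/
lemma chiG_eq_sum_chiX_fiber (p q r n : ℕ) [NeZero q] [NeZero r] (m s t : ℕ)
    (A : Finset (ZMod (p ^ n) × ZMod q × ZMod r)) :
    chiG p q r n m s t A = ∑ j ∈ range q, ∑ k ∈ range r,
      chiX (p ^ n) m (fiber p q r n A j k) *
        Complex.exp (2 * Real.pi * Complex.I / q) ^ (s * j) *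
        Complex.exp (2 * Real.pi * Complex.I / r) ^ (t * k) := by
  rw [← sum_product', chiG, ← sum_fiberwise_of_maps_to (t := range q ×ˢ range r)
    (g := fun g => (g.2.1.val, g.2.2.val))
    (fun g _ => by simp [ZMod.val_lt])]
  refine sum_congr rfl fun ⟨j, k⟩ hjk => ?_
  simp only [mem_product, mem_range] at hjk
  have hval : ∀ {M a : ℕ} [NeZero M] (x : ZMod M), a < M → (x = (a : ZMod M) ↔ x.val = a) := by
    intro M a _ x ha
    rw [← (ZMod.val_injective M).eq_iff, ZMod.val_cast_of_lt ha]
  have hfilter : (A.filter fun g => g.2.1 = (j : ZMod q) ∧ g.2.2 = (k : ZMod r)) =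
      A.filter fun g => (g.2.1.val, g.2.2.val) = (j, k) := by
    refine filter_congr fun g _ => ?_
    rw [hval _ hjk.1, hval _ hjk.2, Prod.mk.injEq]
  rw [chiX, fiber, sum_image, sum_mul, sum_mul, hfilter]
  · refine sum_congr rfl fun g hg => ?_
    obtain ⟨-, hg⟩ := mem_filter.1 hg
    obtain ⟨h1, h2⟩ := Prod.mk.inj hg
    rw [h1, h2, ← Complex.exp_nat_mul, ← Complex.exp_nat_mul, ← Complex.exp_add,
      ← Complex.exp_add]
    congr 1
    push_cast
    ring
  · intro x hx y hy hxy
    simp only [coe_filter, Set.mem_ofPred_eq] at hx hy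
    exact Prod.ext hxy (Prod.ext (hx.2.1.trans hy.2.1.symm) (hx.2.2.trans hy.2.2.symm))

open IntermediateField in
/-- A doubly indexed family in the `N`-th cyclotomic field is constant when its Fourier
coefficients at the frequencies `(1, 1)`, `(0, 1)` and `(1, 0)` vanish. -/
lemma eq_of_fourier_eq_zero {K : Type*} [Field K] [CharZero K] {N q r : ℕ} (hN : 0 < N)
    (hq : q.Prime) (hr : r.Prime) (hcq : N.Coprime q) (hcr : N.Coprime r) (hqr : q ≠ r)
    {η ζ : K} (hη : IsPrimitiveRoot η (N * r)) (hζ : IsPrimitiveRoot ζ q)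
    {a : ℕ → ℕ → K} (ha : ∀ j k, a j k ∈ ℚ⟮η ^ r⟯)
    (h1 : ∑ j ∈ range q, ∑ k ∈ range r, a j k * ζ ^ j * (η ^ N) ^ k = 0)
    (h2 : ∑ j ∈ range q, ∑ k ∈ range r, a j k * (η ^ N) ^ k = 0)
    (h3 : ∑ j ∈ range q, ∑ k ∈ range r, a j k * ζ ^ j = 0)
    {j k : ℕ} (hj : j < q) (hk : k < r) : a j k = a 0 0 := by
  have hNr : 0 < N * r := Nat.mul_pos hN hr.pos
  have hω : IsPrimitiveRoot (η ^ r) N := hη.pow hNr (Nat.mul_comm N r)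
  have hξ : IsPrimitiveRoot (η ^ N) r := hη.pow hNr rfl
  have hcrq : (N * r).Coprime q :=
    Nat.Coprime.mul_left hcq ((Nat.coprime_primes hr hq).2 hqr.symm)
  have hηm : η ∈ ℚ⟮η⟯ := mem_adjoin_simple_self ℚ η
  have hle : ℚ⟮η ^ r⟯ ≤ ℚ⟮η⟯ := adjoin_simple_le_iff.2 (pow_mem hηm r)
  have hr0 : (r : K) ≠ 0 := Nat.cast_ne_zero.2 hr.ne_zero
  have hq0 : (q : K) ≠ 0 := Nat.cast_ne_zero.2 hq.ne_zero
  have hrow : ∀ j < q, ∑ k ∈ range r, a j k = ∑ k ∈ range r, a 0 k := fun j hj =>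
    hζ.coeff_eq_of_sum_pow_eq_zero (b := fun j => ∑ k ∈ range r, a j k) hω hN hq hcq
      (fun j => sum_mem fun k _ => ha j k) (by simpa [sum_mul] using h3) hj
  have hcol : ∀ k < r, ∑ j ∈ range q, a j k = ∑ j ∈ range q, a j 0 := fun k hk =>
    hξ.coeff_eq_of_sum_pow_eq_zero (b := fun k => ∑ j ∈ range q, a j k) hω hN hr hcr
      (fun k => sum_mem fun j _ => ha j k)
      (by rw [sum_comm] at h2; simpa [sum_mul] using h2) hk
  have htwist : ∀ j < q, ∑ k ∈ range r, a j k * (η ^ N) ^ k =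
      ∑ k ∈ range r, a 0 k * (η ^ N) ^ k :=
    fun j hj => hζ.coeff_eq_of_sum_pow_eq_zero (b := fun j => ∑ k ∈ range r, a j k * (η ^ N) ^ k)
      hη hNr hq hcrq
      (fun j => sum_mem fun k _ => mul_mem (hle (ha j k)) (pow_mem (pow_mem hηm N) k))
      (by simpa [sum_mul, mul_right_comm] using h1) hj
  have hconst : ∀ j < q, ∀ k < r, a j k = a 0 k := by
    intro j hj
    have hdiff : ∀ k < r, a j k - a 0 k = a j 0 - a 0 0 := fun k hk =>
      hξ.coeff_eq_of_sum_pow_eq_zero (b := fun k => a j k - a 0 k) hω hN hr hcr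
        (fun k => sub_mem (ha j k) (ha 0 k))
        (by simp only [sub_mul, sum_sub_distrib, htwist j hj, sub_self]) hk
    have hzero : a j 0 - a 0 0 = 0 := by
      have hsum : ∑ k ∈ range r, (a j k - a 0 k) = 0 := by
        rw [sum_sub_distrib, hrow j hj, sub_self]
      rw [sum_congr rfl fun k hk => hdiff k (mem_range.1 hk), sum_const, card_range,
        nsmul_eq_mul] at hsum
      exact (mul_eq_zero.1 hsum).resolve_left hr0
    exact fun k hk => sub_eq_zero.1 ((hdiff k hk).trans hzero)
  have hk0 := hcol k hk
  rw [sum_congr rfl fun j hj => hconst j (mem_range.1 hj) k hk,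
    sum_congr rfl fun j hj => hconst j (mem_range.1 hj) 0 hr.pos, sum_const, sum_const,
    card_range, nsmul_eq_mul, nsmul_eq_mul] at hk0
  exact (hconst j hj k hk).trans (mul_left_cancel₀ hq0 hk0)

theorem fiber_eq_base_of_three_zeros (p q r n : ℕ) (hp : p.Prime) (hq : q.Prime)
    (hr : r.Prime) (hpq : p ≠ q) (hpr : p ≠ r) (hqr : q ≠ r) (hn : 0 < n)
    (A : Finset (ZMod (p ^ n) × ZMod q × ZMod r)) (i : ℕ) (hi : i ≤ n)
    (h1 : chiG p q r n (p ^ i) 1 1 A = 0)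
    (h2 : chiG p q r n (p ^ i) 0 1 A = 0)
    (h3 : chiG p q r n (p ^ i) 1 0 A = 0) :
    ∀ j < q, ∀ k < r,
      chiX (p ^ n) (p ^ i) (fiber p q r n A j k) =
        chiX (p ^ n) (p ^ i) (fiber p q r n A 0 0) := by
  have hP : 0 < p ^ n := pow_pos hp.pos n
  have : NeZero q := ⟨hq.ne_zero⟩
  have : NeZero r := ⟨hr.ne_zero⟩
  have hr0 : (r : ℂ) ≠ 0 := Nat.cast_ne_zero.2 hr.ne_zero
  have hp0 : ((p ^ n : ℕ) : ℂ) ≠ 0 := Nat.cast_ne_zero.2 hP.ne'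
  have hω : Complex.exp (2 * Real.pi * Complex.I / (p ^ n : ℕ)) =
      Complex.exp (2 * Real.pi * Complex.I / (p ^ n * r : ℕ)) ^ r := by
    rw [← Complex.exp_nat_mul, Nat.cast_mul]
    congr 1
    field_simp
  have hξ : Complex.exp (2 * Real.pi * Complex.I / r) =
      Complex.exp (2 * Real.pi * Complex.I / (p ^ n * r : ℕ)) ^ (p ^ n) := by
    rw [← Complex.exp_nat_mul, Nat.cast_mul]
    congr 1
    field_simp
  rw [chiG_eq_sum_chiX_fiber, hξ] at h1 h2 h3
  simp only [one_mul, zero_mul, pow_zero, mul_one] at h1 h2 h3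
  intro j hj k hk
  exact eq_of_fourier_eq_zero (a := fun j k => chiX (p ^ n) (p ^ i) (fiber p q r n A j k))
    hP hq hr
    (Nat.Coprime.pow_left n ((Nat.coprime_primes hp hq).2 hpq))
    (Nat.Coprime.pow_left n ((Nat.coprime_primes hp hr).2 hpr)) hqr
    (Complex.isPrimitiveRoot_exp (p ^ n * r) (Nat.mul_pos hP hr.pos).ne')
    (Complex.isPrimitiveRoot_exp q hq.ne_zero)
    (fun j k => chiX_mem (hω ▸ IntermediateField.mem_adjoin_simple_self ℚ _) _ _)
    h1 h2 h3 hj hk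
end

section
/- Let p, q, r be distinct primes, n a positive integer, N = p^n·q·r, and let (A,B) be a spectral pair in Z_N. (1) If the residues of q and r lie in Z_A but the residue of qr does not lie in Z_A, then the residues of p^n·q and p^n·r both lie in Z_B. (2) Symmetrically, if the residues of q and r lie in Z_B but the residue of qr does not lie in Z_B, then the residues of p^n·q and p^n·r both lie in Z_A. -/
open Finset

/-- `chi N A b = ∑_{a ∈ A} e^{2πi·ab/N}`. -/
noncomputable def chi (N : ℕ) (A : Finset (ZMod N)) (b : ZMod N) : ℂ :=
  ∑ a ∈ A, Complex.exp (2 * Real.pi * Complex.I * ((a * b).val : ℕ) / N)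

/-- `(A, B)` is a spectral pair in `Z_N`. -/
def IsSpectralPair (N : ℕ) (A B : Finset (ZMod N)) : Prop :=
  A.card = B.card ∧ ∀ b ∈ B, ∀ b' ∈ B, b ≠ b' → chi N A (b - b') = 0

open Polynomial in
/-- A vanishing sum of powers of a primitive root of unity of order `p ^ (m + 1) * r` has exponents
whose residues modulo `p ^ (m + 1)` are counted, modulo `r`, by a `p ^ m`-periodic function. -/
lemma card_filter_modEq_of_sum_pow_eq_zero {ι K : Type*} [Field K] [CharZero K] {p r m : ℕ}
    (hp : p.Prime) (hr : r.Prime) (hpr : p ≠ r) {ζ : K} (hζ : IsPrimitiveRoot ζ (p ^ (m + 1) * r))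
    (s : Finset ι) (f : ι → ℕ) (hs : ∑ i ∈ s, ζ ^ f i = 0) (x : ZMod (p ^ (m + 1))) :
    #{i ∈ s | (f i : ZMod (p ^ (m + 1))) = x} ≡
      #{i ∈ s | (f i : ZMod (p ^ (m + 1))) = x + (p ^ m : ℕ)} [MOD r] := by
  have : Fact p.Prime := ⟨hp⟩
  have : Fact r.Prime := ⟨hr⟩
  have hpos : 0 < p ^ (m + 1) * r := Nat.mul_pos (pow_pos hp.pos _) hr.pos
  have hdvd : cyclotomic (p ^ (m + 1) * r) ℤ ∣ ∑ i ∈ s, (X : ℤ[X]) ^ f i := by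
    rw [cyclotomic_eq_minpoly hζ hpos]
    exact minpoly.isIntegrallyClosed_dvd (hζ.isIntegral hpos) (by simpa using hs)
  have hdvd' : (X : (ZMod r)[X]) ^ p ^ (m + 1) - 1 ∣
      (∑ i ∈ s, (X : (ZMod r)[X]) ^ f i) * (X ^ p ^ m - 1) := by
    have h := Polynomial.map_dvd (Int.castRingHom (ZMod r)) hdvd
    rw [map_cyclotomic, cyclotomic_mul_prime_eq_pow_of_not_dvd (ZMod r)
      (fun h => hpr ((Nat.prime_dvd_prime_iff_eq hr hp).1 (hr.dvd_of_dvd_pow h)).symm)] at h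
    simp only [Polynomial.map_sum, Polynomial.map_pow, map_X] at h
    rw [← cyclotomic_prime_pow_mul_X_pow_sub_one (ZMod r) p m]
    exact mul_dvd_mul_right
      ((dvd_pow_self _ (Nat.sub_ne_zero_of_lt hr.one_lt)).trans h) _
  have hzero := map_dvd (aeval (AddMonoidAlgebra.single (1 : ZMod (p ^ (m + 1))) (1 : ZMod r)))
    hdvd'
  have hone : AddMonoidAlgebra.single (0 : ZMod (p ^ (m + 1))) (1 : ZMod r) = 1 := rfl
  simp only [map_sub, map_mul, map_sum, map_pow, aeval_X, map_one, AddMonoidAlgebra.single_pow,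
    one_pow, nsmul_one, CharP.cast_eq_zero, hone, sub_self, zero_dvd_iff, mul_sub, mul_one,
    sum_mul, AddMonoidAlgebra.single_mul_single] at hzero
  rw [sub_eq_zero] at hzero
  have hcoeff := congrArg (fun z => z.coeff (x + (p ^ m : ℕ))) hzero
  simp only [AddMonoidAlgebra.coeff_sum, AddMonoidAlgebra.coeff_single, Finsupp.finsetSum_apply,
    Finsupp.single_apply, add_left_inj, sum_boole] at hcoeff
  exact (ZMod.natCast_eq_natCast_iff _ _ _).1 hcoeff

lemma sum_pow_eq_zero_of_card_filter_eq {ι K : Type*} [Field K] {p m : ℕ}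
    (hp : p.Prime) {ζ : K} (hζ : IsPrimitiveRoot ζ (p ^ (m + 1)))
    (s : Finset ι) (f : ι → ℕ)
    (h : ∀ x : ZMod (p ^ (m + 1)), #{i ∈ s | (f i : ZMod (p ^ (m + 1))) = x} =
      #{i ∈ s | (f i : ZMod (p ^ (m + 1))) = x + (p ^ m : ℕ)}) :
    ∑ i ∈ s, ζ ^ f i = 0 := by
  have : NeZero (p ^ (m + 1)) := ⟨(pow_pos hp.pos _).ne'⟩
  have hpow : ∀ i : ℕ, ζ ^ (i : ZMod (p ^ (m + 1))).val = ζ ^ i := fun i => by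
    rw [ZMod.val_natCast, hζ.eq_orderOf, pow_mod_orderOf]
  have hsum : ∑ i ∈ s, ζ ^ f i = ∑ x : ZMod (p ^ (m + 1)),
      (#{i ∈ s | (f i : ZMod (p ^ (m + 1))) = x} : K) * ζ ^ x.val := by
    rw [← sum_fiberwise s (fun i => (f i : ZMod (p ^ (m + 1))))]
    refine sum_congr rfl fun x _ => ?_
    rw [sum_congr rfl (g := fun _ => ζ ^ x.val), sum_const, nsmul_eq_mul]
    intro i hi
    rw [← (mem_filter.1 hi).2, hpow]
  have hshift : ∑ i ∈ s, ζ ^ f i = ζ ^ p ^ m * ∑ i ∈ s, ζ ^ f i := by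
    conv_lhs => rw [hsum, ← Equiv.sum_comp (Equiv.addRight ((p ^ m : ℕ) : ZMod (p ^ (m + 1))))]
    rw [hsum, mul_sum]
    refine sum_congr rfl fun x _ => ?_
    rw [Equiv.coe_addRight, ← h x, mul_left_comm, ← pow_add, ← hpow (p ^ m + x.val)]
    congr 3
    rw [Nat.cast_add, ZMod.natCast_zmod_val]
    exact add_comm x _
  have hne : ζ ^ p ^ m ≠ 1 :=
    hζ.pow_ne_one_of_pos_of_lt (pow_pos hp.pos _).ne'
      (Nat.pow_lt_pow_right hp.one_lt (Nat.lt_succ_self m))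
  by_contra h0
  exact hne (mul_right_cancel₀ h0 (by rw [one_mul, ← hshift]))

lemma chi_eq_sum_stdAddChar (N : ℕ) [NeZero N] (A : Finset (ZMod N)) (b : ZMod N) :
    chi N A b = ∑ a ∈ A, ZMod.stdAddChar (a * b) := by
  simp [chi, ZMod.stdAddChar_apply, ZMod.toCircle_apply]

lemma chi_natCast (N : ℕ) [NeZero N] (A : Finset (ZMod N)) (k : ℕ) :
    chi N A k = ∑ a ∈ A, (Complex.exp (2 * Real.pi * Complex.I / N) ^ k) ^ a.val := by
  rw [chi_eq_sum_stdAddChar]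
  refine sum_congr rfl fun a _ => ?_
  have : a * (k : ZMod N) = ((k * a.val : ℤ) : ZMod N) := by
    push_cast
    rw [ZMod.natCast_zmod_val, mul_comm]
  rw [this, ZMod.stdAddChar_coe, ← pow_mul, ← Complex.exp_nat_mul]
  congr 1
  push_cast
  ring

open Matrix in
lemma IsSpectralPair.symm {N : ℕ} [NeZero N] {A B : Finset (ZMod N)}
    (h : IsSpectralPair N A B) : IsSpectralPair N B A := by
  refine ⟨h.1.symm, fun a ha a' ha' hne => ?_⟩
  have hA : (#A : ℂ) ≠ 0 := Nat.cast_ne_zero.2 (card_ne_zero_of_mem ha)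
  let M : Matrix B A ℂ := of fun b a => ZMod.stdAddChar (a.1 * b.1)
  have hM : M * ((#A : ℂ)⁻¹ • Mᴴ) = 1 := by
    ext b b'
    have hb : (M * Mᴴ) b b' = chi N A (b - b') := by
      rw [chi_eq_sum_stdAddChar, ← sum_coe_sort A, mul_apply]
      refine sum_congr rfl fun a _ => ?_
      simp only [M, of_apply, conjTranspose_apply]
      rw [mul_sub, sub_eq_add_neg, AddChar.map_add_eq_mul, AddChar.map_neg_eq_conj]
      rfl
    rw [Matrix.mul_smul, Matrix.smul_apply, hb, one_apply]
    split_ifs with hbb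
    · simp [hbb, chi, hA]
    · rw [h.2 b b.2 b' b'.2 (fun e => hbb (Subtype.ext e)), smul_zero]
  rw [mul_eq_one_comm_of_card_eq _ _ _ (by simp [h.1])] at hM
  have hentry := congrFun (congrFun hM ⟨a', ha'⟩) ⟨a, ha⟩
  have hconj : (Mᴴ * M) ⟨a', ha'⟩ ⟨a, ha⟩ = chi N B (a - a') := by
    rw [chi_eq_sum_stdAddChar, ← sum_coe_sort B, mul_apply]
    refine sum_congr rfl fun b _ => ?_
    simp only [M, of_apply, conjTranspose_apply]
    rw [mul_sub, sub_eq_add_neg, AddChar.map_add_eq_mul, AddChar.map_neg_eq_conj, mul_comm a,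
      mul_comm a', mul_comm]
    simp [mul_comm]
  rw [smul_mul, Matrix.smul_apply, hconj, one_apply_ne (by simpa using hne.symm), smul_eq_zero] at hentry
  exact hentry.resolve_left (inv_ne_zero hA)

lemma mem_of_mul_le_card_filter {M k : ℕ} [NeZero (M * k)] {A : Finset (ZMod (M * k))}
    {y : ZMod M} (h : k ≤ #{a ∈ A | (a.val : ZMod M) = y}) {a : ZMod (M * k)}
    (ha : (a.val : ZMod M) = y) : a ∈ A := by
  have : NeZero M := ⟨left_ne_zero_of_mul (NeZero.ne (M * k))⟩
  let T : Finset (ZMod (M * k)) := (range k).image fun j => ((y.val + M * j : ℕ) : ZMod (M * k))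
  have hT : ∀ b : ZMod (M * k), (b.val : ZMod M) = y → b ∈ T := fun b hb => by
    refine mem_image.2 ⟨b.val / M, mem_range.2 (Nat.div_lt_of_lt_mul (ZMod.val_lt b)), ?_⟩
    rw [← hb, ZMod.val_natCast, Nat.mod_add_div, ZMod.natCast_zmod_val]
  have hsub : {a ∈ A | (a.val : ZMod M) = y} ⊆ T := fun b hb => hT b (mem_filter.1 hb).2
  have heq := eq_of_subset_of_card_le hsub ((card_image_le.trans (card_range k).le).trans h)
  exact (mem_filter.1 (heq ▸ hT a ha)).1

lemma chi_eq_zero_of_chi_eq_zero (p q r m : ℕ) (hp : p.Prime) (hq : q.Prime) (hr : r.Prime)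
    (hpq : p ≠ q) (hpr : p ≠ r) (hqr : q ≠ r) (N : ℕ) (hN : N = p ^ (m + 1) * q * r)
    (A B : Finset (ZMod N)) (hAB : IsSpectralPair N A B)
    (h1 : chi N A (q : ℕ) = 0) (h2 : chi N A (r : ℕ) = 0) (h3 : chi N A (q * r : ℕ) ≠ 0) :
    chi N B (p ^ (m + 1) * q : ℕ) = 0 ∧ chi N B (p ^ (m + 1) * r : ℕ) = 0 := by
  rw [mul_assoc] at hN
  subst hN
  have hM : 0 < p ^ (m + 1) := pow_pos hp.pos _
  have hpos : 0 < p ^ (m + 1) * (q * r) := Nat.mul_pos hM (Nat.mul_pos hq.pos hr.pos)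
  have : NeZero (p ^ (m + 1) * (q * r)) := ⟨hpos.ne'⟩
  have hω := Complex.isPrimitiveRoot_exp _ hpos.ne'
  rw [chi_natCast] at h1 h2 h3
  have hcr := card_filter_modEq_of_sum_pow_eq_zero (m := m) hp hr hpr (hω.pow hpos (by ring)) A _ h1
  have hcq := card_filter_modEq_of_sum_pow_eq_zero (m := m) hp hq hpq (hω.pow hpos (by ring)) A _ h2
  have hex : ∃ y : ZMod (p ^ (m + 1)),
      q * r ≤ #{a ∈ A | (a.val : ZMod (p ^ (m + 1))) = y} := by
    by_contra! hlt
    refine h3 (sum_pow_eq_zero_of_card_filter_eq (m := m) hp (hω.pow hpos (by ring)) A _ fun x => ?_)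
    exact ((Nat.modEq_and_modEq_iff_modEq_mul ((Nat.coprime_primes hq hr).2 hqr)).1
      ⟨hcq x, hcr x⟩).eq_of_lt_of_lt (hlt _) (hlt _)
  obtain ⟨y, hy⟩ := hex
  have : NeZero (p ^ (m + 1)) := ⟨hM.ne'⟩
  have hmem : ∀ j : ℕ, ((y.val + p ^ (m + 1) * j : ℕ) : ZMod (p ^ (m + 1) * (q * r))) ∈ A := by
    refine fun j => mem_of_mul_le_card_filter hy ?_
    rw [ZMod.val_natCast, (ZMod.natCast_eq_natCast_iff _ _ _).2
      ((Nat.mod_modEq _ _).of_mul_right _), Nat.cast_add, Nat.cast_mul, ZMod.natCast_self,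
      zero_mul, add_zero, ZMod.natCast_zmod_val]
  have key : ∀ j : ℕ, 0 < j → j < q * r →
      chi (p ^ (m + 1) * (q * r)) B (p ^ (m + 1) * j : ℕ) = 0 := fun j hj hlt => by
    have hne : ((p ^ (m + 1) * j : ℕ) : ZMod (p ^ (m + 1) * (q * r))) ≠ 0 := by
      rw [Ne, ZMod.natCast_eq_zero_iff]
      exact Nat.not_dvd_of_pos_of_lt (Nat.mul_pos hM hj) (Nat.mul_lt_mul_of_pos_left hlt hM)
    have hsub : ((y.val + p ^ (m + 1) * j : ℕ) : ZMod (p ^ (m + 1) * (q * r))) -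
        ((y.val + p ^ (m + 1) * 0 : ℕ) : ZMod (p ^ (m + 1) * (q * r))) =
        ((p ^ (m + 1) * j : ℕ) : ZMod (p ^ (m + 1) * (q * r))) := by
      push_cast
      ring
    rw [← hsub] at hne ⊢
    exact hAB.symm.2 _ (hmem j) _ (hmem 0) (sub_ne_zero.1 hne)
  exact ⟨key q hq.pos (lt_mul_of_one_lt_right hq.pos hr.one_lt),
    key r hr.pos (lt_mul_of_one_lt_left hr.pos hq.one_lt)⟩

theorem zeros_transfer (p q r n : ℕ) (hp : p.Prime) (hq : q.Prime) (hr : r.Prime)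
    (hpq : p ≠ q) (hpr : p ≠ r) (hqr : q ≠ r) (hn : 0 < n)
    (N : ℕ) (hN : N = p ^ n * q * r)
    (A B : Finset (ZMod N)) (hAB : IsSpectralPair N A B) :
    (chi N A ((q : ℕ) : ZMod N) = 0 → chi N A ((r : ℕ) : ZMod N) = 0 →
      chi N A ((q * r : ℕ) : ZMod N) ≠ 0 →
      chi N B ((p ^ n * q : ℕ) : ZMod N) = 0 ∧ chi N B ((p ^ n * r : ℕ) : ZMod N) = 0) ∧
    (chi N B ((q : ℕ) : ZMod N) = 0 → chi N B ((r : ℕ) : ZMod N) = 0 →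
      chi N B ((q * r : ℕ) : ZMod N) ≠ 0 →
      chi N A ((p ^ n * q : ℕ) : ZMod N) = 0 ∧ chi N A ((p ^ n * r : ℕ) : ZMod N) = 0) := by
  obtain ⟨m, rfl⟩ := Nat.exists_eq_add_one.2 hn
  have : NeZero N := ⟨hN ▸ mul_ne_zero (mul_ne_zero (pow_pos hp.pos _).ne' hq.ne_zero) hr.ne_zero⟩
  exact ⟨chi_eq_zero_of_chi_eq_zero p q r m hp hq hr hpq hpr hqr N hN A B hAB,
    chi_eq_zero_of_chi_eq_zero p q r m hp hq hr hpq hpr hqr N hN B A hAB.symm⟩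
end

section
/- Let p, q, r be distinct primes, n a positive integer, N = p^n·q·r, and let (A,B) be a spectral pair in Z_N satisfying the standing assumptions. (1) If at most one of the residues p^n·q and p^n·r lies in Z_B, then the residue of 1 lies in Z_A (i.e., ∑_{a∈A} e^{2πi·a/N} = 0). (2) Symmetrically, if at most one of the residues p^n·q and p^n·r lies in Z_A, then the residue of 1 lies in Z_B. -/
open Finset

/-- `A` tiles `Z_N` by translation. -/
def Tiles (N : ℕ) (A : Finset (ZMod N)) : Prop :=
  ∃ T : Finset (ZMod N), ∀ g : ZMod N,
    ∃! x : ZMod N × ZMod N, x.1 ∈ A ∧ x.2 ∈ T ∧ x.1 + x.2 = g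

/-- `A` is a union of cosets of the subgroup `{x : m·x = 0}` of `Z_N`
(for `m` a prime divisor of `N` this is the unique subgroup of order `m`). -/
def IsUnionOfCosets (N : ℕ) (m : ℕ) (A : Finset (ZMod N)) : Prop :=
  ∀ a ∈ A, ∀ x : ZMod N, (m : ZMod N) * x = 0 → a + x ∈ A

namespace SpectralPair

open Polynomial

/-- The mask polynomial `∑_{a ∈ S} X ^ a` of a finite set of exponents. -/
noncomputable def maskPoly (S : Finset ℕ) : ℤ[X] := ∑ a ∈ S, X ^ a

/-- The number of elements of `S` congruent to `k` modulo `M`. -/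
def residueCount (S : Finset ℕ) (M : ℕ) (k : ℤ) : ℕ := #{a ∈ S | ((a : ℕ) : ℤ) ≡ k [ZMOD M]}

lemma isRelPrime_cyclotomic {d e : ℕ} (hd : 0 < d) (he : 0 < e) (hne : d ≠ e) :
    IsRelPrime (cyclotomic d ℤ) (cyclotomic e ℤ) := by
  refine ((cyclotomic.irreducible hd).isRelPrime_iff_not_dvd).2 fun h => hne ?_
  have h1 := (cyclotomic.irreducible hd).associated_of_dvd (cyclotomic.irreducible he) h
  exact cyclotomic_injective (R := ℤ)
    (eq_of_monic_of_associated (cyclotomic.monic d ℤ) (cyclotomic.monic e ℤ) h1)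

/-- A product of distinct cyclotomic polynomials divides `f` as soon as each factor does. -/
lemma prod_cyclotomic_dvd {ι : Type*} (J : Finset ι) (d : ι → ℕ) (hd : ∀ i ∈ J, 0 < d i)
    (hinj : Set.InjOn d J) {f : ℤ[X]} (hf : ∀ i ∈ J, cyclotomic (d i) ℤ ∣ f) :
    ∏ i ∈ J, cyclotomic (d i) ℤ ∣ f :=
  Finset.prod_dvd_of_isRelPrime
    (fun i hi j hj hij => isRelPrime_cyclotomic (hd i hi) (hd j hj)
      fun h => hij (hinj hi hj h)) hf

/-- The sum of the coefficients of a polynomial over the exponents in a residue class. -/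
noncomputable def residueSum (M : ℕ) (k : ZMod M) : ℤ[X] →ₗ[ℤ] ℤ :=
  lsum fun m => if (m : ZMod M) = k then LinearMap.id else 0

lemma residueSum_monomial (M : ℕ) (k : ZMod M) (m : ℕ) (c : ℤ) :
    residueSum M k (monomial m c) = if (m : ZMod M) = k then c else 0 := by
  simp only [residueSum, lsum, LinearMap.coe_mk, AddHom.coe_mk]
  rw [sum_monomial_index _ _ (by simp)]
  split_ifs <;> rfl

lemma residueSum_X_pow_mul (M : ℕ) (k : ZMod M) (m : ℕ) (f : ℤ[X]) :
    residueSum M k (X ^ m * f) = residueSum M (k - m) f := by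
  induction f using Polynomial.induction_on' with
  | add f g hf hg => rw [mul_add, map_add, map_add, hf, hg]
  | monomial n c =>
    rw [X_pow_mul_monomial, residueSum_monomial, residueSum_monomial]
    simp [eq_sub_iff_add_eq]

lemma residueSum_eq_zero_of_dvd {M : ℕ} (k : ZMod M) {f : ℤ[X]} (h : X ^ M - 1 ∣ f) :
    residueSum M k f = 0 := by
  obtain ⟨g, rfl⟩ := h
  rw [sub_mul, map_sub, residueSum_X_pow_mul]
  simp

lemma residueSum_maskPoly (S : Finset ℕ) (M : ℕ) (k : ℤ) :
    residueSum M (k : ZMod M) (maskPoly S) = residueCount S M k := by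
  simp only [maskPoly, map_sum, residueCount, ← monomial_one_right_eq_X_pow,
    residueSum_monomial, Finset.card_filter, Nat.cast_sum]
  refine Finset.sum_congr rfl fun a _ => ?_
  have : ((a : ZMod M) = (k : ZMod M)) ↔ (a : ℤ) ≡ k [ZMOD M] := by
    rw [← ZMod.intCast_eq_intCast_iff]; simp
  by_cases h : (a : ℤ) ≡ k [ZMOD M] <;> simp [this, h]

lemma X_pow_sub_one_dvd {M u v : ℕ} (hM : 0 < M) {f : ℤ[X]} (hf : cyclotomic M ℤ ∣ f)
    (hdiv : ∀ d, d ∣ M → d ≠ M → d ∣ u ∨ d ∣ v) :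
    X ^ M - 1 ∣ f * (X ^ u - 1) * (X ^ v - 1) := by
  rw [← prod_cyclotomic_eq_X_pow_sub_one hM]
  refine prod_cyclotomic_dvd _ (fun i => i) (fun i hi => Nat.pos_of_mem_divisors hi)
    (fun _ _ _ _ h => h) fun d hd => ?_
  by_cases hdM : d = M
  · subst hdM; exact (hf.mul_right _).mul_right _
  have key : ∀ {w : ℕ}, d ∣ w → cyclotomic d ℤ ∣ X ^ w - 1 := fun h =>
    (cyclotomic.dvd_X_pow_sub_one d ℤ).trans (by
      obtain ⟨c, rfl⟩ := h
      simpa [pow_mul] using sub_dvd_pow_sub_pow ((X : ℤ[X]) ^ d) 1 c)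
  rcases hdiv d (Nat.dvd_of_mem_divisors hd) hdM with h | h
  · exact ((key h).mul_left _).mul_right _
  · exact (key h).mul_left _

lemma residueCount_congr (S : Finset ℕ) {M : ℕ} {k l : ℤ} (h : k ≡ l [ZMOD M]) :
    residueCount S M k = residueCount S M l := by
  unfold residueCount
  congr 1
  exact Finset.filter_congr fun a _ => ⟨fun h' => h'.trans h, fun h' => h'.trans h.symm⟩

/-- If `Φ_M` divides the mask polynomial and every proper divisor of `M` divides `u` or `v`,
the residue counts modulo `M` satisfy the parallelogram relation for shifts by `u` and `v`. -/
lemma residueCount_add_residueCount {S : Finset ℕ} {M u v : ℕ} (hM : 0 < M)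
    (hu : u ∣ M) (hv : v ∣ M)
    (hdiv : ∀ d, d ∣ M → d ≠ M → d ∣ u ∨ d ∣ v) (hf : cyclotomic M ℤ ∣ maskPoly S)
    {k₁ k₂ k₃ k₄ : ℤ} (h₁₂ : k₁ ≡ k₂ [ZMOD u]) (h₁₃ : k₁ ≡ k₃ [ZMOD v])
    (h₄ : k₁ + k₄ ≡ k₂ + k₃ [ZMOD M]) :
    residueCount S M k₁ + residueCount S M k₄ = residueCount S M k₂ + residueCount S M k₃ := by
  have hM' : (0 : ℤ) < M := by exact_mod_cast hM
  obtain ⟨s, hs⟩ := Int.eq_ofNat_of_zero_le (Int.emod_nonneg (k₁ - k₂) hM'.ne')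
  obtain ⟨t, ht⟩ := Int.eq_ofNat_of_zero_le (Int.emod_nonneg (k₁ - k₃) hM'.ne')
  have hsM : (s : ℤ) ≡ k₁ - k₂ [ZMOD M] := by rw [← hs]; exact Int.mod_modEq _ _
  have htM : (t : ℤ) ≡ k₁ - k₃ [ZMOD M] := by rw [← ht]; exact Int.mod_modEq _ _
  have hus : u ∣ s := by
    have h1 : (s : ℤ) ≡ 0 [ZMOD u] :=
      (hsM.of_dvd (by exact_mod_cast hu)).trans (by simpa using h₁₂.sub_right k₂)
    exact_mod_cast (Int.modEq_zero_iff_dvd.1 h1)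
  have hvt : v ∣ t := by
    have h1 : (t : ℤ) ≡ 0 [ZMOD v] :=
      (htM.of_dvd (by exact_mod_cast hv)).trans (by simpa using h₁₃.sub_right k₃)
    exact_mod_cast (Int.modEq_zero_iff_dvd.1 h1)
  have hdvd := X_pow_sub_one_dvd hM hf (u := s) (v := t) fun d hd hne =>
    (hdiv d hd hne).imp (·.trans hus) (·.trans hvt)
  have hz := residueSum_eq_zero_of_dvd (k₁ : ZMod M) hdvd
  have hexp : maskPoly S * (X ^ s - 1) * (X ^ t - 1) = X ^ t * (X ^ s * maskPoly S)
      - X ^ s * maskPoly S - X ^ t * maskPoly S + maskPoly S := by ring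
  rw [hexp] at hz
  simp only [map_add, map_sub, residueSum_X_pow_mul] at hz
  have e2 : (k₁ : ZMod M) - (s : ZMod M) = ((k₂ : ℤ) : ZMod M) := by
    have := (ZMod.intCast_eq_intCast_iff _ _ _).2 hsM
    push_cast at this; rw [this]; ring
  have e3 : (k₁ : ZMod M) - (t : ZMod M) = ((k₃ : ℤ) : ZMod M) := by
    have := (ZMod.intCast_eq_intCast_iff _ _ _).2 htM
    push_cast at this; rw [this]; ring
  have e4 : (k₁ : ZMod M) - (t : ZMod M) - (s : ZMod M) = ((k₄ : ℤ) : ZMod M) := by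
    have h1 := (ZMod.intCast_eq_intCast_iff _ _ _).2 h₄
    push_cast at h1
    rw [e3, ← sub_eq_iff_eq_add'.2 h1.symm] at *
    linear_combination e2 - h1
  rw [e2, e4, e3, residueSum_maskPoly, residueSum_maskPoly, residueSum_maskPoly,
    residueSum_maskPoly] at hz
  omega

/-- The parallelogram relation for a modulus of the form `p ^ (e + 1) * q`. -/
lemma residueCount_add_residueCount_prime_pow_mul {S : Finset ℕ} {p q e : ℕ} (hp : p.Prime)
    (hq : q.Prime) (hpq : p ≠ q) (hf : cyclotomic (p ^ (e + 1) * q) ℤ ∣ maskPoly S)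
    {k₁ k₂ k₃ k₄ : ℤ} (h₁₂ : k₁ ≡ k₂ [ZMOD (p ^ e * q : ℕ)])
    (h₁₃ : k₁ ≡ k₃ [ZMOD (p ^ (e + 1) : ℕ)]) (h₄₂ : k₄ ≡ k₂ [ZMOD (p ^ (e + 1) : ℕ)])
    (h₄₃ : k₄ ≡ k₃ [ZMOD (q : ℕ)]) :
    residueCount S (p ^ (e + 1) * q) k₁ + residueCount S (p ^ (e + 1) * q) k₄ =
      residueCount S (p ^ (e + 1) * q) k₂ + residueCount S (p ^ (e + 1) * q) k₃ := by
  have hcop : (p ^ (e + 1)).Coprime q := ((Nat.coprime_primes hp hq).2 hpq).pow_left _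
  refine residueCount_add_residueCount (u := p ^ e * q) (v := p ^ (e + 1))
    (Nat.mul_pos (pow_pos hp.pos _) hq.pos)
    (Nat.mul_dvd_mul_right (pow_dvd_pow p e.le_succ) q) (dvd_mul_right _ _) ?_ hf h₁₂ h₁₃ ?_
  · intro d hd hne
    by_cases hqd : q ∣ d
    · obtain ⟨d', rfl⟩ := hqd
      have hd' : d' ∣ p ^ (e + 1) := by
        rw [mul_comm] at hd; exact Nat.dvd_of_mul_dvd_mul_right hq.pos hd
      obtain ⟨f, hf, rfl⟩ := (Nat.dvd_prime_pow hp).1 hd'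
      have : f ≠ e + 1 := by rintro rfl; exact hne (mul_comm _ _)
      left
      rw [mul_comm]
      exact Nat.mul_dvd_mul_right (pow_dvd_pow p (by omega)) q
    · right
      exact (((Nat.Prime.coprime_iff_not_dvd hq).2 hqd).symm).dvd_of_dvd_mul_right hd
  · push_cast
    refine (Int.modEq_and_modEq_iff_modEq_mul (by simpa [Int.natAbs_pow] using hcop)).1 ⟨?_, ?_⟩
    · have := h₁₃.add h₄₂
      push_cast at this
      rwa [add_comm k₃] at this
    · exact (h₁₂.of_dvd (by push_cast; exact dvd_mul_left _ _)).add h₄₃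

/-- If `Φ_q` divides the mask polynomial for a prime `q`, the set is equidistributed mod `q`. -/
lemma residueCount_eq_of_cyclotomic_prime_dvd {S : Finset ℕ} {q : ℕ} (hq : q.Prime)
    (hf : cyclotomic q ℤ ∣ maskPoly S) (k l : ℤ) :
    residueCount S q k = residueCount S q l := by
  have hdvd : X ^ q - 1 ∣ maskPoly S * (X - 1) := by
    rw [← prod_cyclotomic_eq_X_pow_sub_one hq.pos, hq.prod_divisors, cyclotomic_one]
    exact mul_dvd_mul_right hf _
  have hstep : ∀ k : ℤ, residueCount S q k = residueCount S q (k - 1) := fun k => by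
    have := residueSum_eq_zero_of_dvd (k : ZMod q) hdvd
    have hexp : maskPoly S * (X - 1) = X ^ 1 * maskPoly S - maskPoly S := by ring
    rw [hexp, map_sub, residueSum_X_pow_mul, residueSum_maskPoly] at this
    have e : (k : ZMod q) - ((1 : ℕ) : ZMod q) = ((k - 1 : ℤ) : ZMod q) := by push_cast; ring
    rw [e, residueSum_maskPoly] at this
    omega
  have h0 : ∀ k : ℤ, residueCount S q k = residueCount S q 0 := fun k => by
    induction k with
    | zero => rfl
    | succ n ih => rw [hstep, ← ih]; congr 1; ring
    | pred n ih => rw [← ih]; exact (hstep _).symm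
  rw [h0, h0 l]

lemma cyclotomic_dvd_maskPoly_iff {S : Finset ℕ} {M : ℕ} (hM : 0 < M) {ω : ℂ}
    (hω : IsPrimitiveRoot ω M) : cyclotomic M ℤ ∣ maskPoly S ↔ ∑ a ∈ S, ω ^ a = 0 := by
  rw [cyclotomic_eq_minpoly hω hM,
    ← minpoly.isIntegrallyClosed_dvd_iff (hω.isIntegral hM)]
  simp [maskPoly]

/-- If the residue counts modulo `M` are invariant under a shift by `h`, the mask polynomial
vanishes at every `M`-th root of unity `ω` with `ω ^ h ≠ 1`. -/
lemma sum_pow_eq_zero_of_residueCount_add {S : Finset ℕ} {M h : ℕ} [NeZero M]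
    (hinv : ∀ k : ℤ, residueCount S M (k + h) = residueCount S M k) {ω : ℂ}
    (hω : ω ^ M = 1) (hωh : ω ^ h ≠ 1) : ∑ a ∈ S, ω ^ a = 0 := by
  have hmod : ∀ a b : ℕ, (a : ZMod M) = b → ω ^ a = ω ^ b := fun a b hab => by
    rw [pow_eq_pow_mod a hω, pow_eq_pow_mod b hω, (ZMod.natCast_eq_natCast_iff' a b M).1 hab]
  have hsum : ∑ a ∈ S, ω ^ a = ∑ k : ZMod M, (residueCount S M (k.val : ℤ) : ℂ) * ω ^ k.val := by
    rw [← Finset.sum_fiberwise S (fun a : ℕ => (a : ZMod M))]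
    refine Finset.sum_congr rfl fun k _ => ?_
    have : residueCount S M (k.val : ℤ) = #{a ∈ S | ((a : ℕ) : ZMod M) = k} := by
      unfold residueCount
      congr 1
      refine Finset.filter_congr fun a _ => ?_
      rw [← ZMod.intCast_eq_intCast_iff]; simp
    rw [this, ← nsmul_eq_mul, ← Finset.sum_const]
    refine Finset.sum_congr rfl fun a ha => hmod _ _ ?_
    simpa using (Finset.mem_filter.1 ha).2
  have hshift : ∑ k : ZMod M, (residueCount S M (k.val : ℤ) : ℂ) * ω ^ k.val =
      ω ^ h * ∑ k : ZMod M, (residueCount S M (k.val : ℤ) : ℂ) * ω ^ k.val := by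
    conv_lhs => rw [← Equiv.sum_comp (Equiv.addRight (h : ZMod M))]
    rw [Finset.mul_sum]
    refine Finset.sum_congr rfl fun k _ => ?_
    have h1 : ω ^ ((k + h : ZMod M)).val = ω ^ h * ω ^ k.val := by
      rw [← pow_add]; apply hmod; simp [add_comm]
    have h2 : residueCount S M ((k + h : ZMod M).val : ℤ) = residueCount S M (k.val : ℤ) := by
      rw [← hinv (k.val : ℤ)]
      apply residueCount_congr
      rw [← ZMod.intCast_eq_intCast_iff]; simp
    simp only [Equiv.coe_addRight]
    rw [h1, h2]; ring
  rw [hsum]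
  have : (1 - ω ^ h) * ∑ k : ZMod M, (residueCount S M (k.val : ℤ) : ℂ) * ω ^ k.val = 0 := by
    rw [sub_mul, one_mul, ← hshift, sub_self]
  exact (mul_eq_zero.1 this).resolve_left (sub_ne_zero.2 (Ne.symm hωh))

/-- `|S|` is divisible by one factor `p` for each cyclotomic divisor of prime power index. -/
lemma pow_card_dvd_card {S : Finset ℕ} {p n : ℕ} (hp : p.Prime) {J : Finset ℕ}
    (hJ : ∀ j ∈ J, j < n ∧ cyclotomic (p ^ (n - j)) ℤ ∣ maskPoly S) : p ^ #J ∣ #S := by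
  have := Fact.mk hp
  have h := prod_cyclotomic_dvd J (fun j => p ^ (n - j)) (fun _ _ => pow_pos hp.pos _)
    (fun i hi j hj hij => by
      have := Nat.pow_right_injective hp.two_le hij
      have := (hJ i hi).1; have := (hJ j hj).1; omega) fun j hj => (hJ j hj).2
  have h1 := eval_dvd (x := (1 : ℤ)) h
  rw [eval_prod, Finset.prod_congr rfl (g := fun _ => (p : ℤ)) fun j hj => by
    obtain ⟨k, hk⟩ : ∃ k, n - j = k + 1 := ⟨n - j - 1, by have := (hJ j hj).1; omega⟩
    rw [hk, eval_one_cyclotomic_prime_pow]] at h1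
  simp only [Finset.prod_const, maskPoly, eval_finsetSum, eval_pow, eval_X, one_pow,
    Finset.sum_const, nsmul_eq_mul, mul_one] at h1
  exact_mod_cast h1

/-- A set whose distinct elements first differ, in base `p`, at a digit in `J` has at most
`p ^ |J|` elements. -/
lemma card_le_pow_card {E J : Finset ℕ} {p : ℕ} (hp : 0 < p)
    (h : ∀ a ∈ E, ∀ b ∈ E, a ≠ b → ∃ j ∈ J, a ≡ b [MOD p ^ j] ∧ ¬ a ≡ b [MOD p ^ (j + 1)]) :
    #E ≤ p ^ #J := by
  classical
  let f : ℕ → (J → Fin p) := fun a j => ⟨a / p ^ (j : ℕ) % p, Nat.mod_lt _ hp⟩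
  have hcard : #(Finset.univ : Finset (J → Fin p)) = p ^ #J := by simp
  rw [← hcard]
  refine Finset.card_le_card_of_injOn f (fun _ _ => by simp) fun a ha b hb hab => ?_
  by_contra hne
  obtain ⟨j, hj, h1, h2⟩ := h a ha b hb hne
  refine h2 ?_
  have h3 : a / p ^ j % p = b / p ^ j % p := by
    simpa [f] using congrFun hab ⟨j, hj⟩
  unfold Nat.ModEq at *
  rw [Nat.mod_pow_succ, Nat.mod_pow_succ, h1, h3]

lemma modEq_natMul_iff {m n : ℕ} (h : m.Coprime n) {a b : ℤ} :
    a ≡ b [ZMOD (m * n : ℕ)] ↔ a ≡ b [ZMOD m] ∧ a ≡ b [ZMOD n] := by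
  rw [Nat.cast_mul]
  exact (Int.modEq_and_modEq_iff_modEq_mul (by simpa using h)).symm

lemma exists_modEq_modEq {m n : ℕ} (h : m.Coprime n) (x y : ℤ) :
    ∃ k : ℤ, k ≡ x [ZMOD m] ∧ k ≡ y [ZMOD n] := by
  have hbez := Nat.gcd_eq_gcd_ab m n
  rw [h.gcd_eq_one, Nat.cast_one] at hbez
  refine ⟨x + m * (m.gcdA n * (y - x)), ?_, ?_⟩
  · exact (Int.modEq_iff_dvd.2 ⟨-(m.gcdA n * (y - x)), by ring⟩)
  · exact (Int.modEq_iff_dvd.2 ⟨m.gcdB n * (y - x), by linear_combination (y - x) * hbez⟩)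

lemma residueCount_pos {S : Finset ℕ} {M : ℕ} {k : ℤ} {a : ℕ} (ha : a ∈ S)
    (h : (a : ℤ) ≡ k [ZMOD M]) : 0 < residueCount S M k :=
  Finset.card_pos.2 ⟨a, Finset.mem_filter.2 ⟨ha, h⟩⟩

lemma exists_of_residueCount_pos {S : Finset ℕ} {M : ℕ} {k : ℤ} (h : 0 < residueCount S M k) :
    ∃ a ∈ S, (a : ℤ) ≡ k [ZMOD M] := by
  obtain ⟨a, ha⟩ := Finset.card_pos.1 h
  exact ⟨a, (Finset.mem_filter.1 ha).1, (Finset.mem_filter.1 ha).2⟩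

lemma residueCount_eq_zero {S : Finset ℕ} {M : ℕ} {k : ℤ}
    (h : ∀ a ∈ S, ¬ (a : ℤ) ≡ k [ZMOD M]) : residueCount S M k = 0 :=
  Finset.card_eq_zero.2 (Finset.filter_eq_empty_iff.2 fun a ha => h a ha)

/-- A residue class modulo `m` splits into `q` residue classes modulo `m * q`. -/
lemma residueCount_eq_sum (S : Finset ℕ) {m q : ℕ} (hm : 0 < m) (hq : 0 < q) (x : ℤ) :
    residueCount S m x = ∑ j ∈ Finset.range q, residueCount S (m * q) (x + m * j) := by
  have hm' : (m : ℤ) ≠ 0 := by exact_mod_cast hm.ne'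
  have hq' : (0 : ℤ) < q := by exact_mod_cast hq
  rw [residueCount, Finset.card_eq_sum_card_fiberwise
    (f := fun a : ℕ => ((((a : ℤ) - x) / m) % q).toNat) (t := Finset.range q)]
  · refine Finset.sum_congr rfl fun j hj => ?_
    rw [residueCount, Finset.filter_filter]
    congr 1
    refine Finset.filter_congr fun a _ => ?_
    have hj' : (j : ℤ) < q := by exact_mod_cast Finset.mem_range.1 hj
    have h0 := Int.emod_nonneg (((a : ℤ) - x) / m) hq'.ne'
    constructor
    · rintro ⟨h1, h2⟩
      obtain ⟨c, hc⟩ := Int.modEq_iff_dvd.1 h1.symm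
      rw [hc, Int.mul_ediv_cancel_left _ hm'] at h2 h0
      have h3 : c % q = j := by omega
      have h4 := Int.emod_add_mul_ediv c q
      refine Int.modEq_iff_dvd.2 ⟨-(c / q), ?_⟩
      push_cast
      linear_combination (-1 : ℤ) * hc + m * h4 - m * h3
    · intro h
      obtain ⟨c, hc⟩ := Int.modEq_iff_dvd.1 h.symm
      push_cast at hc
      have h5 : (a : ℤ) - x = m * (j + q * c) := by linear_combination hc
      refine ⟨(Int.modEq_iff_dvd.2 ⟨j + q * c, h5⟩).symm, ?_⟩
      rw [h5, Int.mul_ediv_cancel_left _ hm', Int.add_mul_emod_self_left,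
        Int.emod_eq_of_lt (by omega) hj']
      simp
  · intro a _
    have h0 := Int.emod_nonneg (((a : ℤ) - x) / m) hq'.ne'
    have h1 := Int.emod_lt_of_pos (((a : ℤ) - x) / m) hq'
    simp only [Finset.coe_range, Set.mem_Iio]
    omega

lemma residueCount_eq_mul {S : Finset ℕ} {m q d : ℕ} (hm : 0 < m) (hq : 0 < q) {x : ℤ}
    (h : ∀ k : ℤ, k ≡ x [ZMOD m] → residueCount S (m * q) k = d) :
    residueCount S m x = q * d := by
  rw [residueCount_eq_sum S hm hq, Finset.sum_congr rfl fun (j : ℕ) _ => h (x + m * (j : ℤ)) ?_]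
  · simp
  · exact Int.modEq_iff_dvd.2 ⟨-j, by ring⟩

lemma residueCount_one (S : Finset ℕ) (x : ℤ) : residueCount S 1 x = #S := by
  simp [residueCount, Int.modEq_one]

/-- If all residue classes other than that of `c` contain `d` elements, then these classes
together contain `(q - 1) * d` elements. -/
lemma card_eq_residueCount_add {S : Finset ℕ} {q d : ℕ} (hq : 0 < q) {c : ℤ}
    (h : ∀ k : ℤ, ¬ k ≡ c [ZMOD q] → residueCount S q k = d) :
    #S = residueCount S q c + (q - 1) * d := by
  rw [← residueCount_one S c, residueCount_eq_sum S one_pos hq]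
  obtain ⟨q, rfl⟩ : ∃ m, q = m + 1 := ⟨q - 1, by omega⟩
  rw [Finset.sum_range_succ']
  simp only [one_mul, Nat.cast_one, Nat.cast_zero, add_zero]
  rw [add_comm, Finset.sum_congr rfl fun j hj => h (c + (j + 1 : ℕ)) ?_]
  · simp
  · intro hc
    have h1 : ((q + 1 : ℕ) : ℤ) ∣ (j + 1 : ℕ) := by simpa using Int.modEq_iff_dvd.1 hc.symm
    have h2 := Nat.le_of_dvd (by omega) (Int.natCast_dvd_natCast.1 h1)
    have := Finset.mem_range.1 hj
    omega

/-- For distinct `b, b' ∈ B` the cyclotomic polynomial, whose index is the order of `b - b'`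
modulo `p ^ n * q * r`, divides the mask polynomial of `A`. -/
def DifferencesVanish (p q r n : ℕ) (A B : Finset ℕ) : Prop :=
  ∀ b ∈ B, ∀ b' ∈ B, b ≠ b' → ∀ j ≤ n, (b : ℤ) ≡ b' [ZMOD (p ^ j : ℕ)] →
    (j = n ∨ ¬ (b : ℤ) ≡ b' [ZMOD (p ^ (j + 1) : ℕ)]) →
    cyclotomic (p ^ (n - j) * (if (b : ℤ) ≡ b' [ZMOD q] then 1 else q) *
      (if (b : ℤ) ≡ b' [ZMOD r] then 1 else r)) ℤ ∣ maskPoly A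

lemma DifferencesVanish.swap {p q r n : ℕ} {A B : Finset ℕ} (h : DifferencesVanish p q r n A B) :
    DifferencesVanish p r q n A B := fun b hb b' hb' hne j hj h1 h2 => by
  rw [mul_right_comm]; exact h b hb b' hb' hne j hj h1 h2

/-- No two distinct elements are congruent modulo `M`. -/
def InjMod (M : ℕ) (S : Finset ℕ) : Prop :=
  ∀ a ∈ S, ∀ b ∈ S, (a : ℤ) ≡ b [ZMOD M] → a = b

lemma InjMod.residueCount_le_one {M : ℕ} {S : Finset ℕ} (h : InjMod M S) (k : ℤ) :
    residueCount S M k ≤ 1 := by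
  refine Finset.card_le_one.2 fun a ha b hb => ?_
  rw [Finset.mem_filter] at ha hb
  exact h a ha.1 b hb.1 (ha.2.trans hb.2.symm)

/-- If `A` meets each coset of the subgroup of order `r` at most once and its mask polynomial
vanishes at the orders `p ^ (e + 1) * q` and `p ^ (e + 1) * r`, then the image of `A` modulo
`p ^ (e + 1) * q` is a union of cosets of the subgroup of order `p`. -/
lemma exists_modEq_of_injMod {A : Finset ℕ} {p q r e : ℕ} (hp : p.Prime) (hq : q.Prime)
    (hr : r.Prime) (hpq : p ≠ q) (hpr : p ≠ r) (hqr : q ≠ r)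
    (hinj : InjMod (p ^ (e + 1) * q) A)
    (hAq : cyclotomic (p ^ (e + 1) * q) ℤ ∣ maskPoly A)
    (hAr : cyclotomic (p ^ (e + 1) * r) ℤ ∣ maskPoly A)
    {a : ℕ} (ha : a ∈ A) {k : ℤ} (hk : k ≡ a [ZMOD (p ^ e * q : ℕ)]) :
    ∃ a' ∈ A, (a' : ℤ) ≡ k [ZMOD (p ^ (e + 1) * q : ℕ)] := by
  by_contra hnone
  push Not at hnone
  have hpe : 0 < p ^ (e + 1) := pow_pos hp.pos _
  have hcq : (p ^ (e + 1)).Coprime q := ((Nat.coprime_primes hp hq).2 hpq).pow_left _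
  have hcr : (p ^ (e + 1)).Coprime r := ((Nat.coprime_primes hp hr).2 hpr).pow_left _
  have hcqe : (p ^ e).Coprime q := ((Nat.coprime_primes hp hq).2 hpq).pow_left _
  have hcre : (p ^ e).Coprime r := ((Nat.coprime_primes hp hr).2 hpr).pow_left _
  have hee : p ^ e ∣ p ^ (e + 1) := pow_dvd_pow p e.le_succ
  have hee' : ((p ^ e : ℕ) : ℤ) ∣ (p ^ (e + 1) : ℕ) := by exact_mod_cast hee
  have hk0 : residueCount A (p ^ (e + 1) * q) k = 0 := residueCount_eq_zero hnone
  have ha1 : residueCount A (p ^ (e + 1) * q) a = 1 :=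
    le_antisymm (hinj.residueCount_le_one _) (residueCount_pos ha rfl)
  have hke := ((modEq_natMul_iff hcqe).1 hk).1
  -- all residues above `a` occur once and none above `k` occurs
  have hfull : ∀ y y' : ℤ, y ≡ a [ZMOD (p ^ (e + 1) : ℕ)] → y' ≡ k [ZMOD (p ^ (e + 1) : ℕ)] →
      y' ≡ y [ZMOD q] → residueCount A (p ^ (e + 1) * q) y = 1 ∧
        residueCount A (p ^ (e + 1) * q) y' = 0 := fun y y' hy hy' hyy => by
    have h := residueCount_add_residueCount_prime_pow_mul hp hq hpq hAq
      (k₁ := a) (k₂ := k) (k₃ := y) (k₄ := y') hk.symm hy.symm hy' hyy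
    have h1 := hinj.residueCount_le_one y
    omega
  have hA : residueCount A (p ^ (e + 1)) a = q * 1 :=
    residueCount_eq_mul hpe hq.pos fun y hy => by
      obtain ⟨y', h1, h2⟩ := exists_modEq_modEq hcq k y
      exact (hfull y y' hy h1 h2).1
  have hK : ∀ y' : ℤ, y' ≡ k [ZMOD (p ^ (e + 1) : ℕ)] → ∀ b ∈ A,
      ¬ (b : ℤ) ≡ y' [ZMOD (p ^ (e + 1) : ℕ)] := fun y' hy' b hb hby => by
    obtain ⟨y, h1, h2⟩ := exists_modEq_modEq hcq a b
    have h3 := (hfull y b h1 (hby.trans hy') h2.symm).2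
    have h4 := residueCount_pos hb (M := p ^ (e + 1) * q) (k := b) rfl
    omega
  have hK0 : ∀ y' : ℤ, y' ≡ k [ZMOD (p ^ (e + 1) : ℕ)] →
      residueCount A (p ^ (e + 1) * r) y' = 0 := fun y' hy' =>
    residueCount_eq_zero fun b hb h => hK y' hy' b hb ((modEq_natMul_iff hcr).1 h).1
  have hA' : residueCount A (p ^ (e + 1)) a = r * residueCount A (p ^ (e + 1) * r) a :=
    residueCount_eq_mul hpe hr.pos fun z hz => by
      obtain ⟨k', h1, h2⟩ := exists_modEq_modEq hcr k a
      obtain ⟨k'', h3, h4⟩ := exists_modEq_modEq hcr k z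
      have h := residueCount_add_residueCount_prime_pow_mul hp hr hpr hAr
        (k₁ := a) (k₂ := k') (k₃ := z) (k₄ := k'')
        ((modEq_natMul_iff hcre).2 ⟨((h1.of_dvd hee').trans hke).symm, h2.symm⟩) hz.symm
        (h3.trans h1.symm) h4
      rw [hK0 _ h1, hK0 _ h3] at h
      omega
  have : r ∣ q := ⟨_, by rw [← hA', hA, mul_one]⟩
  exact hqr ((Nat.prime_dvd_prime_iff_eq hr hq).1 this).symm

/-- In the situation of `exists_modEq_of_injMod`, the image of `A` modulo `p ^ (e + 1)` is
equidistributed along cosets of the subgroup of order `p`. -/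
lemma cyclotomic_prime_pow_dvd_of_injMod {A : Finset ℕ} {p q r e : ℕ} (hp : p.Prime)
    (hq : q.Prime) (hr : r.Prime) (hpq : p ≠ q) (hpr : p ≠ r) (hqr : q ≠ r)
    (hinj : InjMod (p ^ (e + 1) * q) A)
    (hAq : cyclotomic (p ^ (e + 1) * q) ℤ ∣ maskPoly A)
    (hAr : cyclotomic (p ^ (e + 1) * r) ℤ ∣ maskPoly A) :
    cyclotomic (p ^ (e + 1)) ℤ ∣ maskPoly A := by
  have hpe : 0 < p ^ (e + 1) := pow_pos hp.pos _
  have : NeZero (p ^ (e + 1) * q) := ⟨(Nat.mul_pos hpe hq.pos).ne'⟩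
  have hω := Complex.isPrimitiveRoot_exp (p ^ (e + 1)) hpe.ne'
  rw [cyclotomic_dvd_maskPoly_iff hpe hω]
  have hmod : ∀ k l : ℤ, k ≡ l [ZMOD (p ^ e * q : ℕ)] →
      0 < residueCount A (p ^ (e + 1) * q) k → 0 < residueCount A (p ^ (e + 1) * q) l := by
    intro k l hkl hk
    obtain ⟨a, ha, hak⟩ := exists_of_residueCount_pos hk
    have hd : ((p ^ e * q : ℕ) : ℤ) ∣ (p ^ (e + 1) * q : ℕ) := by
      exact_mod_cast Nat.mul_dvd_mul_right (pow_dvd_pow p e.le_succ) q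
    obtain ⟨a', ha', h⟩ := exists_modEq_of_injMod hp hq hr hpq hpr hqr hinj hAq hAr ha
      (((hak.of_dvd hd).trans hkl).symm)
    exact residueCount_pos ha' h
  refine sum_pow_eq_zero_of_residueCount_add (M := p ^ (e + 1) * q) (h := p ^ e * q)
    (fun k => ?_) ?_ ?_
  · have hkl : k + (p ^ e * q : ℕ) ≡ k [ZMOD (p ^ e * q : ℕ)] := by simp
    have h1 := hinj.residueCount_le_one k
    have h2 := hinj.residueCount_le_one (k + (p ^ e * q : ℕ))
    have h3 := hmod _ _ hkl
    have h4 := hmod _ _ hkl.symm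
    omega
  · rw [pow_mul, hω.pow_eq_one, one_pow]
  · intro h
    have h1 := hω.dvd_of_pow_eq_one _ h
    rw [pow_succ] at h1
    have h2 := Nat.dvd_of_mul_dvd_mul_left (pow_pos hp.pos e) h1
    exact hpq ((Nat.prime_dvd_prime_iff_eq hp hq).1 h2)

lemma exists_digit {p q r n : ℕ} {A B : Finset ℕ}
    (hcop : (p ^ n * q).Coprime r) (hcop' : (p ^ n).Coprime q)
    (hB : InjMod (p ^ n * q * r) B) (hv : DifferencesVanish p q r n A B)
    {a b : ℕ} (ha : a ∈ B) (hb : b ∈ B) (hne : a ≠ b) (hq : (a : ℤ) ≡ b [ZMOD q])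
    (hr : (a : ℤ) ≡ b [ZMOD r]) :
    ∃ j < n, (a : ℤ) ≡ b [ZMOD (p ^ j : ℕ)] ∧ ¬ (a : ℤ) ≡ b [ZMOD (p ^ (j + 1) : ℕ)] ∧
      cyclotomic (p ^ (n - j)) ℤ ∣ maskPoly A := by
  have hn : ¬ (a : ℤ) ≡ b [ZMOD (p ^ n : ℕ)] := fun h =>
    hne (hB a ha b hb ((modEq_natMul_iff hcop).2 ⟨(modEq_natMul_iff hcop').2 ⟨h, hq⟩, hr⟩))
  classical
  have hex : ∃ j, ¬ (a : ℤ) ≡ b [ZMOD (p ^ j : ℕ)] := ⟨n, hn⟩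
  have hj0 : Nat.find hex ≠ 0 := fun h => by
    have := Nat.find_spec hex
    rw [h] at this
    exact this (by simp [Int.modEq_one])
  obtain ⟨j, hj⟩ := Nat.exists_eq_succ_of_ne_zero hj0
  have hjn : j < n := by have := Nat.find_min' hex hn; omega
  have h1 : (a : ℤ) ≡ b [ZMOD (p ^ j : ℕ)] := not_not.1 (Nat.find_min hex (m := j) (by omega))
  have h2 : ¬ (a : ℤ) ≡ b [ZMOD (p ^ (j + 1) : ℕ)] := by
    have := Nat.find_spec hex
    rwa [hj] at this
  refine ⟨j, hjn, h1, h2, ?_⟩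
  have := hv a ha b hb hne j hjn.le h1 (Or.inr h2)
  simpa [hq, hr] using this

/-- A part of `B` on which residues modulo `q` and `r` are constant is bounded by a power of `p`
dividing `|A|`. -/
lemma exists_pow_dvd_card {p q r n : ℕ} {A B E : Finset ℕ} (hp : p.Prime)
    (hcop : (p ^ n * q).Coprime r) (hcop' : (p ^ n).Coprime q)
    (hB : InjMod (p ^ n * q * r) B) (hv : DifferencesVanish p q r n A B) (hE : E ⊆ B)
    (hq : ∀ a ∈ E, ∀ b ∈ E, (a : ℤ) ≡ b [ZMOD q])
    (hr : ∀ a ∈ E, ∀ b ∈ E, (a : ℤ) ≡ b [ZMOD r]) :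
    ∃ s, #E ≤ p ^ s ∧ p ^ s ∣ #A := by
  classical
  refine ⟨#{j ∈ Finset.range n | cyclotomic (p ^ (n - j)) ℤ ∣ maskPoly A},
    card_le_pow_card hp.pos fun a ha b hb hne => ?_, pow_card_dvd_card hp (n := n) fun j hj => ?_⟩
  · obtain ⟨j, hj, h1, h2, h3⟩ := exists_digit hcop hcop' hB hv (hE ha) (hE hb) hne
      (hq a ha b hb) (hr a ha b hb)
    exact ⟨j, by simp [hj, h3], Int.natCast_modEq_iff.1 h1, fun h => h2 (Int.natCast_modEq_iff.2 h)⟩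
  · simpa using hj

/-- The bound of `exists_pow_dvd_card` improves by a factor `p` if residues modulo `p` are also
constant and the mask polynomial of `A` vanishes at the order `p ^ n`. -/
lemma exists_pow_succ_dvd_card {p q r n : ℕ} {A B E : Finset ℕ} (hp : p.Prime) (hn : 0 < n)
    (hcop : (p ^ n * q).Coprime r) (hcop' : (p ^ n).Coprime q)
    (hB : InjMod (p ^ n * q * r) B) (hv : DifferencesVanish p q r n A B) (hE : E ⊆ B)
    (hA : cyclotomic (p ^ n) ℤ ∣ maskPoly A)
    (hpE : ∀ a ∈ E, ∀ b ∈ E, (a : ℤ) ≡ b [ZMOD p])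
    (hq : ∀ a ∈ E, ∀ b ∈ E, (a : ℤ) ≡ b [ZMOD q])
    (hr : ∀ a ∈ E, ∀ b ∈ E, (a : ℤ) ≡ b [ZMOD r]) :
    ∃ s, #E ≤ p ^ s ∧ p ^ (s + 1) ∣ #A := by
  classical
  set J := {j ∈ Finset.range n | cyclotomic (p ^ (n - j)) ℤ ∣ maskPoly A} with hJ
  have h0 : 0 ∈ J := by simp [hJ, hn, hA]
  refine ⟨#(J.erase 0), card_le_pow_card hp.pos fun a ha b hb hne => ?_, ?_⟩
  · obtain ⟨j, hj, h1, h2, h3⟩ := exists_digit hcop hcop' hB hv (hE ha) (hE hb) hne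
      (hq a ha b hb) (hr a ha b hb)
    have hj0 : j ≠ 0 := by
      rintro rfl
      exact h2 (by simpa using hpE a ha b hb)
    exact ⟨j, by simp [hJ, hj, h3, hj0], Int.natCast_modEq_iff.1 h1,
      fun h => h2 (Int.natCast_modEq_iff.2 h)⟩
  · rw [Finset.card_erase_add_one h0]
    exact pow_card_dvd_card hp (n := n) fun j hj => by simpa [hJ] using hj

/-- All elements agree with a common centre in at least two of three coordinates. -/
def IsStar {α X Y Z : Type*} (S : Finset α) (f : α → X) (g : α → Y) (h : α → Z) : Prop :=
  ∃ u ∈ S, ∃ v ∈ S, ∃ w ∈ S, ∀ t ∈ S,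
    (f t = f u ∧ g t = g v) ∨ (g t = g v ∧ h t = h w) ∨ (f t = f u ∧ h t = h w)

/-- The triples of coordinates form the even words over three two-letter alphabets. -/
def IsParity {α X Y Z : Type*} (S : Finset α) (f : α → X) (g : α → Y) (h : α → Z) : Prop :=
  ∃ a ∈ S, ∃ b ∈ S, ∃ c ∈ S, ∃ d ∈ S, f a = f c ∧ f b = f d ∧ g a = g d ∧ g b = g c ∧
    h a = h b ∧ h c = h d ∧ f a ≠ f b ∧ g a ≠ g b ∧ h a ≠ h c ∧
    ∀ t ∈ S, (f t = f a ∧ g t = g a ∧ h t = h a) ∨ (f t = f b ∧ g t = g b ∧ h t = h b) ∨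
      (f t = f c ∧ g t = g c ∧ h t = h c) ∨ (f t = f d ∧ g t = g d ∧ h t = h d)

lemma IsStar.rotate {α X Y Z : Type*} {S : Finset α} {f : α → X} {g : α → Y} {h : α → Z}
    (hS : IsStar S f g h) : IsStar S g h f := by
  obtain ⟨u, hu, v, hv, w, hw, H⟩ := hS
  exact ⟨v, hv, w, hw, u, hu, fun t ht => by have := H t ht; tauto⟩

lemma IsParity.rotate {α X Y Z : Type*} {S : Finset α} {f : α → X} {g : α → Y} {h : α → Z}
    (hS : IsParity S f g h) : IsParity S g h f := by
  obtain ⟨a, ha, b, hb, c, hc, d, hd, h1, h2, h3, h4, h5, h6, h7, h8, h9, H⟩ := hS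
  refine ⟨a, ha, c, hc, d, hd, b, hb, h3, h4.symm, h5, h6, h1, h2.symm, ?_, h9, ?_, ?_⟩
  · rwa [← h4]
  · rwa [← h2]
  · intro t ht; have := H t ht; tauto

lemma isStar_or_isParity_of_ne {α X Y Z : Type*} {S : Finset α} {f : α → X} {g : α → Y}
    {h : α → Z} (hS : ∀ a ∈ S, ∀ b ∈ S, f a = f b ∨ g a = g b ∨ h a = h b)
    {u v w : α} (hu : u ∈ S) (hv : v ∈ S) (hw : w ∈ S) (hf : f u ≠ f v) (hg : g u ≠ g v)
    (hh : h w ≠ h u) : IsStar S f g h ∨ IsParity S f g h := by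
  have main : ∀ u ∈ S, ∀ v ∈ S, f u ≠ f v → g u ≠ g v → h w ≠ h u → h u = h v →
      f w = f u → g w = g v → IsStar S f g h ∨ IsParity S f g h := by
    intro u hu v hv hf hg hh huv hfw hgw
    by_cases hst : ∀ t ∈ S,
        (f t = f u ∧ g t = g v) ∨ (g t = g v ∧ h t = h u) ∨ (f t = f u ∧ h t = h u)
    · exact Or.inl ⟨u, hu, v, hv, u, hu, hst⟩
    · push Not at hst
      obtain ⟨t, ht, ht1, ht2, ht3⟩ := hst
      have htu := hS t ht u hu
      have htv := hS t ht v hv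
      have htw := hS t ht w hw
      have hft : f t = f v := by grind
      have hgt : g t = g u := by grind
      have hht : h t = h w := by grind
      refine Or.inr ⟨u, hu, v, hv, w, hw, t, ht, hfw.symm, hft.symm, hgt.symm, hgw.symm, huv,
        hht.symm, hf, hg, hh.symm, fun s hs => ?_⟩
      have hsu := hS s hs u hu
      have hsv := hS s hs v hv
      have hsw := hS s hs w hw
      have hst := hS s hs t ht
      grind
  have huv : h u = h v := by have := hS u hu v hv; tauto
  have hwu := hS w hw u hu
  have hwv := hS w hw v hv
  rw [← huv] at hwv
  rcases hwu with h1 | h1 | h1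
  · exact main u hu v hv hf hg hh huv h1 (by grind)
  · exact main v hv u hu hf.symm hg.symm (by rwa [← huv]) huv.symm (by grind) h1
  · exact absurd h1 hh

lemma exists_mem_ne {α X : Type*} {S : Finset α} {f : α → X} (hf : ∃ a ∈ S, ∃ b ∈ S, f a ≠ f b)
    (x : X) : ∃ a ∈ S, f a ≠ x := by
  obtain ⟨a, ha, b, hb, hab⟩ := hf
  by_cases hax : f a = x
  · exact ⟨b, hb, fun hbx => hab (hax.trans hbx.symm)⟩
  · exact ⟨a, ha, hax⟩

/-- A family of triples pairwise agreeing in some coordinate, with no coordinate constant, is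
a star or consists of the even words. -/
lemma isStar_or_isParity {α X Y Z : Type*} {S : Finset α} {f : α → X} {g : α → Y} {h : α → Z}
    (hS : ∀ a ∈ S, ∀ b ∈ S, f a = f b ∨ g a = g b ∨ h a = h b)
    (hf : ∃ a ∈ S, ∃ b ∈ S, f a ≠ f b) (hg : ∃ a ∈ S, ∃ b ∈ S, g a ≠ g b)
    (hh : ∃ a ∈ S, ∃ b ∈ S, h a ≠ h b) : IsStar S f g h ∨ IsParity S f g h := by
  have key1 : ∀ u ∈ S, ∀ v ∈ S, f u ≠ f v → g u ≠ g v → IsStar S f g h ∨ IsParity S f g h := by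
    intro u hu v hv h1 h2
    obtain ⟨w, hw, h3⟩ := exists_mem_ne hh (h u)
    exact isStar_or_isParity_of_ne hS hu hv hw h1 h2 h3
  have key2 : ∀ u ∈ S, ∀ v ∈ S, h u ≠ h v → f u ≠ f v → IsStar S f g h ∨ IsParity S f g h := by
    intro u hu v hv h1 h2
    obtain ⟨w, hw, h3⟩ := exists_mem_ne hg (g u)
    have hS' : ∀ a ∈ S, ∀ b ∈ S, h a = h b ∨ f a = f b ∨ g a = g b := fun a ha b hb => by
      have := hS a ha b hb; tauto
    exact (isStar_or_isParity_of_ne hS' hu hv hw h1 h2 h3).imp (·.rotate) (·.rotate)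
  obtain ⟨a, ha, b, hb, hab⟩ := hf
  by_cases hgab : g a = g b
  · by_cases hhab : h a = h b
    · obtain ⟨c, hc, hca⟩ := exists_mem_ne hg (g a)
      by_cases hfc : f c = f a
      · exact key1 c hc b hb (by rwa [hfc]) (by rwa [← hgab])
      · exact key1 c hc a ha hfc hca
    · exact key2 a ha b hb hhab hab
  · exact key1 a ha b hb hab hgab

lemma exists_agree_only {α X Y Z : Type*} {S : Finset α} {f : α → X} {g : α → Y} {h : α → Z}
    (hS : IsStar S f g h ∨ IsParity S f g h) (hf : ∃ a ∈ S, ∃ b ∈ S, f a ≠ f b)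
    (hg : ∃ a ∈ S, ∃ b ∈ S, g a ≠ g b) : ∃ a ∈ S, ∃ b ∈ S, f a ≠ f b ∧ g a ≠ g b ∧ h a = h b := by
  rcases hS with ⟨u, -, v, -, w, -, H⟩ | ⟨a, ha, b, hb, c, -, d, -, -, -, -, -, h1, -, h2, h3, -⟩
  · obtain ⟨s, hs, hsu⟩ := exists_mem_ne hf (f u)
    obtain ⟨t, ht, htv⟩ := exists_mem_ne hg (g v)
    have h1 := H s hs
    have h2 := H t ht
    exact ⟨s, hs, t, ht, by grind, by grind, by grind⟩
  · exact ⟨a, ha, b, hb, h2, h3, h1⟩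

/-- The parallelogram relation for a product of two distinct primes. -/
lemma residueCount_add_residueCount_mul {S : Finset ℕ} {q r : ℕ} (hq : q.Prime)
    (hr : r.Prime) (hqr : q ≠ r) (hf : cyclotomic (q * r) ℤ ∣ maskPoly S) (x s t : ℤ) :
    ∃ k₂ k₃ k₄ : ℤ, (k₂ ≡ s [ZMOD q] ∧ k₂ ≡ x [ZMOD r]) ∧ (k₃ ≡ x [ZMOD q] ∧ k₃ ≡ t [ZMOD r]) ∧
      (k₄ ≡ s [ZMOD q] ∧ k₄ ≡ t [ZMOD r]) ∧
      residueCount S (q * r) x + residueCount S (q * r) k₄ =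
        residueCount S (q * r) k₂ + residueCount S (q * r) k₃ := by
  have hcop : q.Coprime r := (Nat.coprime_primes hq hr).2 hqr
  obtain ⟨k₂, h2, h2'⟩ := exists_modEq_modEq hcop s x
  obtain ⟨k₃, h3, h3'⟩ := exists_modEq_modEq hcop x t
  obtain ⟨k₄, h4, h4'⟩ := exists_modEq_modEq hcop s t
  have key := residueCount_add_residueCount_prime_pow_mul (S := S) (e := 0) hq hr hqr
    (k₁ := x) (k₂ := k₂) (k₃ := k₃) (k₄ := k₄)
  simp only [zero_add, pow_one, pow_zero, one_mul] at key
  exact ⟨k₂, k₃, k₄, ⟨h2, h2'⟩, ⟨h3, h3'⟩, ⟨h4, h4'⟩,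
    key hf h2'.symm h3.symm (h4.trans h2.symm) (h4'.trans h3'.symm)⟩

lemma residueCount_cross {S : Finset ℕ} {q r : ℕ} (hq : q.Prime) (hr : r.Prime) (hqr : q ≠ r)
    (hf : cyclotomic (q * r) ℤ ∣ maskPoly S) {c s t : ℤ}
    (hc : ∀ b ∈ S, (b : ℤ) ≡ c [ZMOD q] ∨ (b : ℤ) ≡ c [ZMOD r])
    (hs : ¬ s ≡ c [ZMOD q]) (ht : ¬ t ≡ c [ZMOD r]) :
    residueCount S (q * r) c = residueCount S q s + residueCount S r t := by
  have hcop : q.Coprime r := (Nat.coprime_primes hq hr).2 hqr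
  obtain ⟨k₂, k₃, k₄, h2, h3, h4, h⟩ := residueCount_add_residueCount_mul hq hr hqr hf c s t
  have e4 : residueCount S (q * r) k₄ = 0 := residueCount_eq_zero fun b hb hbk => by
    rw [modEq_natMul_iff hcop] at hbk
    rcases hc b hb with h5 | h5
    · exact hs ((h4.1.symm.trans hbk.1.symm).trans h5)
    · exact ht ((h4.2.symm.trans hbk.2.symm).trans h5)
  have e2 : residueCount S (q * r) k₂ = residueCount S q s := by
    unfold residueCount
    congr 1
    refine Finset.filter_congr fun b hb => ?_
    rw [modEq_natMul_iff hcop]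
    refine ⟨fun h5 => h5.1.trans h2.1, fun h5 => ⟨h5.trans h2.1.symm, ?_⟩⟩
    exact ((hc b hb).resolve_left fun h6 => hs (h5.symm.trans h6)).trans h2.2.symm
  have e3 : residueCount S (q * r) k₃ = residueCount S r t := by
    unfold residueCount
    congr 1
    refine Finset.filter_congr fun b hb => ?_
    rw [modEq_natMul_iff hcop]
    refine ⟨fun h5 => h5.2.trans h3.2, fun h5 => ⟨?_, h5.trans h3.2.symm⟩⟩
    exact ((hc b hb).resolve_right fun h6 => ht (h5.symm.trans h6)).trans h3.1.symm
  omega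

/-- Vanishing at the order `q * r` is impossible if some residue modulo `q` and some residue
modulo `r` are not attained. -/
lemma not_cyclotomic_dvd_of_missing {S : Finset ℕ} {q r : ℕ} (hq : q.Prime) (hr : r.Prime)
    (hqr : q ≠ r) (hS : S.Nonempty) (hs : ∃ s : ℤ, ∀ b ∈ S, ¬ (b : ℤ) ≡ s [ZMOD q])
    (ht : ∃ t : ℤ, ∀ b ∈ S, ¬ (b : ℤ) ≡ t [ZMOD r]) : ¬ cyclotomic (q * r) ℤ ∣ maskPoly S := by
  intro hf
  have hcop : q.Coprime r := (Nat.coprime_primes hq hr).2 hqr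
  obtain ⟨s, hs⟩ := hs
  obtain ⟨t, ht⟩ := ht
  obtain ⟨b, hb⟩ := hS
  obtain ⟨k₂, k₃, k₄, h2, h3, -, h⟩ := residueCount_add_residueCount_mul hq hr hqr hf b s t
  have e1 := residueCount_pos hb (M := q * r) (k := b) rfl
  have e2 : residueCount S (q * r) k₂ = 0 := residueCount_eq_zero fun a ha hak =>
    hs a ha (((modEq_natMul_iff hcop).1 hak).1.trans h2.1)
  have e3 : residueCount S (q * r) k₃ = 0 := residueCount_eq_zero fun a ha hak =>
    ht a ha (((modEq_natMul_iff hcop).1 hak).2.trans h3.2)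
  omega

lemma exists_missing_residue {S : Finset ℕ} {q : ℕ} (hq : 3 ≤ q) {x y : ℤ}
    (h : ∀ b ∈ S, (b : ℤ) ≡ x [ZMOD q] ∨ (b : ℤ) ≡ y [ZMOD q]) :
    ∃ s : ℤ, ∀ b ∈ S, ¬ (b : ℤ) ≡ s [ZMOD q] := by
  have hne : ∀ i j : ℤ, i < j → j < i + 3 → ¬ x + i ≡ x + j [ZMOD q] := fun i j h1 h2 h3 => by
    have h4 := Int.le_of_dvd (by omega) (Int.modEq_iff_dvd.1 h3)
    have : (3 : ℤ) ≤ q := by exact_mod_cast hq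
    omega
  by_cases hy : y ≡ x + 1 [ZMOD q]
  · refine ⟨x + 2, fun b hb hbs => ?_⟩
    rcases h b hb with h1 | h1
    · exact hne 0 2 (by norm_num) (by norm_num) (by simpa using h1.symm.trans hbs)
    · exact hne 1 2 (by norm_num) (by norm_num) (hy.symm.trans (h1.symm.trans hbs))
  · refine ⟨x + 1, fun b hb hbs => ?_⟩
    rcases h b hb with h1 | h1
    · exact hne 0 1 (by norm_num) (by norm_num) (by simpa using h1.symm.trans hbs)
    · exact hy (h1.symm.trans hbs)

lemma not_add_one_modEq {q : ℕ} (hq : 1 < q) (c : ℤ) : ¬ c + 1 ≡ c [ZMOD q] := fun h => by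
  have h1 := Int.le_of_dvd one_pos (by simpa using Int.modEq_iff_dvd.1 h.symm)
  omega

/-- Counting the parts of a star whose mask polynomial vanishes at the products of two of the
three primes. -/
lemma card_star {B : Finset ℕ} {p q r : ℕ} (hp : p.Prime) (hq : q.Prime) (hr : r.Prime)
    (hpq : p ≠ q) (hpr : p ≠ r) (hqr : q ≠ r) {c : ℤ}
    (hc : ∀ t ∈ B, ((t : ℤ) ≡ c [ZMOD p] ∧ (t : ℤ) ≡ c [ZMOD q]) ∨
      ((t : ℤ) ≡ c [ZMOD q] ∧ (t : ℤ) ≡ c [ZMOD r]) ∨ ((t : ℤ) ≡ c [ZMOD p] ∧ (t : ℤ) ≡ c [ZMOD r]))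
    (hBpq : cyclotomic (p * q) ℤ ∣ maskPoly B) (hBpr : cyclotomic (p * r) ℤ ∣ maskPoly B)
    (hBqr : cyclotomic (q * r) ℤ ∣ maskPoly B) {s t : ℤ} (hs : ¬ s ≡ c [ZMOD q])
    (ht : ¬ t ≡ c [ZMOD r]) :
    residueCount B (q * r) c = residueCount B q s + residueCount B r t ∧
      #B = 2 * (q * residueCount B q s) ∧ #B = 2 * (r * residueCount B r t) := by
  have hu := not_add_one_modEq hp.one_lt c
  have cross1 := fun x hx => residueCount_cross hq hr hqr hBqr (s := x) (t := t)
    (fun b hb => by have := hc b hb; tauto) hx ht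
  have cross2 := fun y hy => residueCount_cross hq hr hqr hBqr (s := s) (t := y)
    (fun b hb => by have := hc b hb; tauto) hs hy
  have cross3 := residueCount_cross hp hq hpq hBpq (s := c + 1) (t := s)
    (fun b hb => by have := hc b hb; tauto) hu hs
  have cross4 := residueCount_cross hp hr hpr hBpr (s := c + 1) (t := t)
    (fun b hb => by have := hc b hb; tauto) hu ht
  have e1 := cross1 s hs
  have sumq := card_eq_residueCount_add (S := B) hq.pos (c := c) (d := residueCount B q s)
    fun k hk => by have := cross1 k hk; omega
  have sumr := card_eq_residueCount_add (S := B) hr.pos (c := c) (d := residueCount B r t)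
    fun k hk => by have := cross2 k hk; omega
  have cpq : p.Coprime q := (Nat.coprime_primes hp hq).2 hpq
  have cpr : p.Coprime r := (Nat.coprime_primes hp hr).2 hpr
  have cqr : q.Coprime r := (Nat.coprime_primes hq hr).2 hqr
  set G := #{b ∈ B | ((b : ℕ) : ℤ) ≡ c [ZMOD p] ∧ (b : ℤ) ≡ c [ZMOD q] ∧ (b : ℤ) ≡ c [ZMOD r]} with hG
  have i1 : #B + G = residueCount B q c + residueCount B (p * r) c := by
    rw [Finset.card_eq_sum_ones B]
    simp only [hG, residueCount, Finset.card_filter, modEq_natMul_iff cpr,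
      ← Finset.sum_add_distrib]
    refine Finset.sum_congr rfl fun b hb => ?_
    have := hc b hb
    by_cases h1 : (b : ℤ) ≡ c [ZMOD p] <;> by_cases h2 : (b : ℤ) ≡ c [ZMOD q] <;>
      by_cases h3 : (b : ℤ) ≡ c [ZMOD r] <;> simp_all
  have i2 : #B + G = residueCount B r c + residueCount B (p * q) c := by
    rw [Finset.card_eq_sum_ones B]
    simp only [hG, residueCount, Finset.card_filter, modEq_natMul_iff cpq,
      ← Finset.sum_add_distrib]
    refine Finset.sum_congr rfl fun b hb => ?_
    have := hc b hb
    by_cases h1 : (b : ℤ) ≡ c [ZMOD p] <;> by_cases h2 : (b : ℤ) ≡ c [ZMOD q] <;>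
      by_cases h3 : (b : ℤ) ≡ c [ZMOD r] <;> simp_all
  have i3 : #B + (G + G) = residueCount B (p * q) c + residueCount B (p * r) c +
      residueCount B (q * r) c := by
    rw [Finset.card_eq_sum_ones B]
    simp only [hG, residueCount, Finset.card_filter, modEq_natMul_iff cpq, modEq_natMul_iff cpr,
      modEq_natMul_iff cqr, ← Finset.sum_add_distrib]
    refine Finset.sum_congr rfl fun b hb => ?_
    have := hc b hb
    by_cases h1 : (b : ℤ) ≡ c [ZMOD p] <;> by_cases h2 : (b : ℤ) ≡ c [ZMOD q] <;>
      by_cases h3 : (b : ℤ) ≡ c [ZMOD r] <;> simp_all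
  have m1 : q * residueCount B q s = (q - 1) * residueCount B q s + residueCount B q s := by
    rw [← Nat.succ_mul, Nat.succ_eq_add_one, Nat.sub_add_cancel hq.one_le]
  have m2 : r * residueCount B r t = (r - 1) * residueCount B r t + residueCount B r t := by
    rw [← Nat.succ_mul, Nat.succ_eq_add_one, Nat.sub_add_cancel hr.one_le]
  omega

/-- The mask polynomial of a star that is not constant modulo `q` and `r` cannot vanish at all
three products of two primes, given a power of `p` dividing its cardinality which bounds its part
over the centre modulo `q * r`. -/
lemma star_false {B : Finset ℕ} {p q r : ℕ} (hp : p.Prime) (hq : q.Prime) (hr : r.Prime)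
    (hpq : p ≠ q) (hpr : p ≠ r) (hqr : q ≠ r) {c : ℤ}
    (hc : ∀ t ∈ B, ((t : ℤ) ≡ c [ZMOD p] ∧ (t : ℤ) ≡ c [ZMOD q]) ∨
      ((t : ℤ) ≡ c [ZMOD q] ∧ (t : ℤ) ≡ c [ZMOD r]) ∨ ((t : ℤ) ≡ c [ZMOD p] ∧ (t : ℤ) ≡ c [ZMOD r]))
    (hBpq : cyclotomic (p * q) ℤ ∣ maskPoly B) (hBpr : cyclotomic (p * r) ℤ ∣ maskPoly B)
    (hBqr : cyclotomic (q * r) ℤ ∣ maskPoly B) (hs : ∃ s ∈ B, ¬ (s : ℤ) ≡ c [ZMOD q])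
    (ht : ∃ t ∈ B, ¬ (t : ℤ) ≡ c [ZMOD r])
    (hpow : ∃ k, residueCount B (q * r) c ≤ p ^ k ∧ p ^ k ∣ #B) : False := by
  obtain ⟨s, hsB, hs⟩ := hs
  obtain ⟨t, htB, ht⟩ := ht
  obtain ⟨k, hk, hkB⟩ := hpow
  obtain ⟨h1, h2, h3⟩ := card_star hp hq hr hpq hpr hqr hc hBpq hBpr hBqr hs ht
  have hα := residueCount_pos hsB (M := q) (k := s) rfl
  have hβ := residueCount_pos htB (M := r) (k := t) rfl
  set α := residueCount B q s
  set β := residueCount B r t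
  have hne : α ≠ β := fun h => by
    rw [← h] at h3
    exact hqr (Nat.eq_of_mul_eq_mul_right hα (by omega))
  have d1 : p ^ k ∣ 2 * α := by
    refine (((Nat.coprime_primes hp hq).2 hpq).pow_left k).dvd_of_dvd_mul_left (m := q) ?_
    rw [h2] at hkB
    convert hkB using 1; ring
  have d2 : p ^ k ∣ 2 * β := by
    refine (((Nat.coprime_primes hp hr).2 hpr).pow_left k).dvd_of_dvd_mul_left (m := r) ?_
    rw [h3] at hkB
    convert hkB using 1; ring
  have l1 := Nat.le_of_dvd (by omega) d1
  have l2 := Nat.le_of_dvd (by omega) d2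
  omega

lemma IsStar.exists_center {B : Finset ℕ} {p q r : ℕ} (hp : p.Prime) (hq : q.Prime)
    (hr : r.Prime) (hpq : p ≠ q) (hpr : p ≠ r) (hqr : q ≠ r)
    (hB : IsStar B (fun b => (b : ℤ) % p) (fun b => (b : ℤ) % q) (fun b => (b : ℤ) % r)) :
    ∃ c : ℤ, ∀ t ∈ B, ((t : ℤ) ≡ c [ZMOD p] ∧ (t : ℤ) ≡ c [ZMOD q]) ∨
      ((t : ℤ) ≡ c [ZMOD q] ∧ (t : ℤ) ≡ c [ZMOD r]) ∨
      ((t : ℤ) ≡ c [ZMOD p] ∧ (t : ℤ) ≡ c [ZMOD r]) := by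
  obtain ⟨u, -, v, -, w, -, H⟩ := hB
  have cpq : p.Coprime q := (Nat.coprime_primes hp hq).2 hpq
  have cpr : p.Coprime r := (Nat.coprime_primes hp hr).2 hpr
  have cqr : q.Coprime r := (Nat.coprime_primes hq hr).2 hqr
  obtain ⟨k, hk1, hk2⟩ := exists_modEq_modEq cpq u v
  obtain ⟨c, hc1, hc2⟩ := exists_modEq_modEq (cpr.mul_left cqr) k w
  rw [modEq_natMul_iff cpq] at hc1
  refine ⟨c, fun t ht => ?_⟩
  have h1 := hc1.1.trans hk1
  have h2 := hc1.2.trans hk2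
  have := H t ht
  unfold Int.ModEq at *
  rwa [h1, h2, hc2]

lemma exists_of_not_union {A : Finset ℕ} {p q r e : ℕ} (hp : p.Prime) (hq : q.Prime)
    (hr : r.Prime) (hpq : p ≠ q) (hpr : p ≠ r) (hqr : q ≠ r)
    (hinj : InjMod (p ^ (e + 1) * q) A)
    (hAq : cyclotomic (p ^ (e + 1) * q) ℤ ∣ maskPoly A)
    (hAr : cyclotomic (p ^ (e + 1) * r) ℤ ∣ maskPoly A)
    {a : ℕ} (ha : a ∈ A) {k : ℤ} (hk : k ≡ a [ZMOD (p ^ e * q * r : ℕ)])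
    (hkA : ∀ a' ∈ A, ¬ (a' : ℤ) ≡ k [ZMOD (p ^ (e + 1) * q * r : ℕ)]) :
    ∃ a' ∈ A, (a' : ℤ) ≡ k [ZMOD (p ^ (e + 1) : ℕ)] ∧ (a' : ℤ) ≡ k [ZMOD q] ∧
      ¬ (a' : ℤ) ≡ k [ZMOD r] ∧ (a' : ℤ) ≡ a [ZMOD (p ^ e : ℕ)] ∧
      ¬ (a' : ℤ) ≡ a [ZMOD (p ^ (e + 1) : ℕ)] := by
  have cpq : ∀ n, (p ^ n).Coprime q := fun n => ((Nat.coprime_primes hp hq).2 hpq).pow_left n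
  have cr : ∀ n, (p ^ n * q).Coprime r := fun n =>
    Nat.Coprime.mul_left (((Nat.coprime_primes hp hr).2 hpr).pow_left n)
      ((Nat.coprime_primes hq hr).2 hqr)
  rw [modEq_natMul_iff (cr e)] at hk
  obtain ⟨hk1, hkr⟩ := hk
  obtain ⟨a', ha', h⟩ := exists_modEq_of_injMod hp hq hr hpq hpr hqr hinj hAq hAr ha hk1
  rw [modEq_natMul_iff (cpq e)] at hk1
  have h' := h
  rw [modEq_natMul_iff (cpq _)] at h
  have h1 : (a' : ℤ) ≡ k [ZMOD (p ^ e : ℕ)] :=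
    h.1.of_dvd (by exact_mod_cast pow_dvd_pow p e.le_succ)
  refine ⟨a', ha', h.1, h.2, fun h2 => hkA a' ha' ?_, h1.trans hk1.1, fun h2 => hkA a ha ?_⟩
  · rw [modEq_natMul_iff (cr _)]; exact ⟨h', h2⟩
  · rw [modEq_natMul_iff (cr _), modEq_natMul_iff (cpq _)]
    exact ⟨⟨h2.symm.trans h.1, hk1.2.symm⟩, hkr.symm⟩

/-- If `A` is injective modulo `p ^ (e + 1) * q` and modulo `p ^ (e + 1) * r` and is not a union
of fibers in the `p` direction, then the mask polynomial of `B` vanishes at all products of two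
of the three primes. -/
lemma cyclotomic_mul_dvd_of_not_union {A B : Finset ℕ} {p q r e : ℕ} (hp : p.Prime)
    (hq : q.Prime) (hr : r.Prime) (hpq : p ≠ q) (hpr : p ≠ r) (hqr : q ≠ r)
    (hinjq : InjMod (p ^ (e + 1) * q) A) (hinjr : InjMod (p ^ (e + 1) * r) A)
    (hAq : cyclotomic (p ^ (e + 1) * q) ℤ ∣ maskPoly A)
    (hAr : cyclotomic (p ^ (e + 1) * r) ℤ ∣ maskPoly A)
    (hBA : DifferencesVanish p q r (e + 1) B A)
    (hA : ∃ a ∈ A, ∃ k : ℤ, k ≡ a [ZMOD (p ^ e * q * r : ℕ)] ∧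
      ∀ a' ∈ A, ¬ (a' : ℤ) ≡ k [ZMOD (p ^ (e + 1) * q * r : ℕ)]) :
    cyclotomic (p * q) ℤ ∣ maskPoly B ∧ cyclotomic (p * r) ℤ ∣ maskPoly B ∧
      cyclotomic (q * r) ℤ ∣ maskPoly B := by
  obtain ⟨a, ha, k, hk, hkA⟩ := hA
  have hkm : k ≡ a [ZMOD q] ∧ k ≡ a [ZMOD r] :=
    ⟨hk.of_dvd (by exact_mod_cast (dvd_mul_left q _).mul_right r),
      hk.of_dvd (by exact_mod_cast dvd_mul_left r _)⟩
  obtain ⟨b, hb, hb1, hb2, hb3, hb4, hb5⟩ :=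
    exists_of_not_union hp hq hr hpq hpr hqr hinjq hAq hAr ha hk hkA
  obtain ⟨c, hc, hc1, hc2, hc3, hc4, hc5⟩ :=
    exists_of_not_union hp hr hq hpr hpq hqr.symm hinjr hAr hAq ha (k := k)
      (by rwa [mul_right_comm]) (by rwa [mul_right_comm (p ^ (e + 1))])
  have hab := hBA b hb a ha (by rintro rfl; exact hb5 rfl) e e.le_succ hb4 (Or.inr hb5)
  have hac := hBA c hc a ha (by rintro rfl; exact hc5 rfl) e e.le_succ hc4 (Or.inr hc5)
  have hbc := hBA b hb c hc (by rintro rfl; exact hc3 hb2) (e + 1) le_rfl (hb1.trans hc1.symm)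
    (Or.inl rfl)
  rw [if_pos (hb2.trans hkm.1), if_neg fun h => hb3 (h.trans hkm.2.symm)] at hab
  rw [if_neg fun h => hc3 (h.trans hkm.1.symm), if_pos (hc2.trans hkm.2)] at hac
  rw [if_neg fun h => hc3 (h.symm.trans hb2), if_neg fun h => hb3 (h.trans hc2)] at hbc
  simp only [Nat.add_sub_cancel_left, pow_one, mul_one, Nat.sub_self, pow_zero, one_mul]
    at hab hac hbc
  exact ⟨hac, hab, hbc⟩

/-- The case in which `B` is equidistributed modulo `q`. -/
lemma equidistributed_false {A B : Finset ℕ} {p q r n : ℕ} (hp : p.Prime) (hn : 0 < n)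
    (hq : q.Prime) (hpq : p ≠ q) (hcop : (p ^ n * q).Coprime r) (hcard : #A = #B)
    (hB : InjMod (p ^ n * q * r) B) (hAB : DifferencesVanish p q r n A B)
    (hA : cyclotomic (p ^ n) ℤ ∣ maskPoly A) (hBq : cyclotomic q ℤ ∣ maskPoly B)
    (hBne : ∃ a ∈ B, ∃ b ∈ B, (b : ℤ) % q ≠ (a : ℤ) % q)
    (hS : IsStar B (fun b => (b : ℤ) % p) (fun b => (b : ℤ) % q) (fun b => (b : ℤ) % r) ∨
      IsParity B (fun b => (b : ℤ) % p) (fun b => (b : ℤ) % q) (fun b => (b : ℤ) % r)) : False := by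
  have hcop' : (p ^ n).Coprime q := ((Nat.coprime_primes hp hq).2 hpq).pow_left n
  obtain ⟨b₀, hb₀, b₁, hb₁, hb01⟩ := hBne
  set m := residueCount B q b₀ with hm
  have hconst : ∀ x, residueCount B q x = m := fun x =>
    residueCount_eq_of_cyclotomic_prime_dvd hq hBq x b₀
  have hmpos : 0 < m := residueCount_pos hb₀ rfl
  have hBm : #B = q * m := by
    rw [← residueCount_one B 0]
    exact residueCount_eq_mul one_pos hq.pos fun k _ => by rw [one_mul]; exact hconst k
  have hE : ∀ E ⊆ B, (∀ a ∈ E, ∀ b ∈ E, (a : ℤ) ≡ b [ZMOD p]) →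
      (∀ a ∈ E, ∀ b ∈ E, (a : ℤ) ≡ b [ZMOD q]) → (∀ a ∈ E, ∀ b ∈ E, (a : ℤ) ≡ b [ZMOD r]) →
      p * #E ≤ m := by
    intro E hEB h1 h2 h3
    obtain ⟨s, hs1, hs2⟩ := exists_pow_succ_dvd_card hp hn hcop hcop' hB hAB hEB hA h1 h2 h3
    rw [hcard, hBm] at hs2
    have h4 : p ^ (s + 1) ∣ m :=
      (((Nat.coprime_primes hp hq).2 hpq).pow_left (s + 1)).dvd_of_dvd_mul_left hs2
    calc p * #E ≤ p * p ^ s := Nat.mul_le_mul_left _ hs1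
      _ = p ^ (s + 1) := (pow_succ' p s).symm
      _ ≤ m := Nat.le_of_dvd hmpos h4
  have hp2 := hp.two_le
  rcases hS with ⟨u, -, v, -, w, -, H⟩ |
    ⟨a, -, b, -, c, -, d, -, h1, h2, h3, h4, h5, h6, h7, h8, h9, H⟩
  · simp only at H
    obtain ⟨t, htv⟩ : ∃ t : ℕ, (t : ℤ) % q ≠ (v : ℤ) % q := by
      by_cases h : (b₀ : ℤ) % q = (v : ℤ) % q
      · exact ⟨b₁, fun h' => hb01 (h'.trans h.symm)⟩
      · exact ⟨b₀, h⟩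
    have key : ∀ x ∈ B.filter (fun b : ℕ => (b : ℤ) ≡ t [ZMOD q]),
        (x : ℤ) % p = (u : ℤ) % p ∧ (x : ℤ) % q = (t : ℤ) % q ∧ (x : ℤ) % r = (w : ℤ) % r := by
      intro x hx
      rw [Finset.mem_filter] at hx
      have hxt : (x : ℤ) % q = (t : ℤ) % q := hx.2
      have := H x hx.1
      rw [hxt] at this
      tauto
    have := hE (B.filter (fun b : ℕ => (b : ℤ) ≡ t [ZMOD q])) (Finset.filter_subset _ _)
      (fun x hx y hy => (key x hx).1.trans (key y hy).1.symm)
      (fun x hx y hy => (key x hx).2.1.trans (key y hy).2.1.symm)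
      (fun x hx y hy => (key x hx).2.2.trans (key y hy).2.2.symm)
    change p * residueCount B q t ≤ m at this
    rw [hconst] at this
    nlinarith
  · simp only at h1 h2 h3 h4 h5 h6 h7 h8 h9 H
    by_cases hq3 : 3 ≤ q
    · obtain ⟨s, hs⟩ := exists_missing_residue (S := B) (x := a) (y := b) hq3 fun t ht => by
        have := H t ht
        rw [← h3, ← h4] at this
        exact (show (t : ℤ) % q = (a : ℤ) % q ∨ (t : ℤ) % q = (b : ℤ) % q by tauto)
      have := residueCount_eq_zero hs
      rw [hconst] at this
      omega
    · have hq2 : q = 2 := le_antisymm (by omega) hq.two_le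
      have hp3 : 3 ≤ p := by omega
      set cls : ℕ → Finset ℕ := fun y => B.filter fun x : ℕ =>
        (x : ℤ) % p = (y : ℤ) % p ∧ (x : ℤ) % q = (y : ℤ) % q ∧ (x : ℤ) % r = (y : ℤ) % r with hcls
      have hcl : ∀ y, p * #(cls y) ≤ m := fun y =>
        hE _ (Finset.filter_subset _ _)
          (fun x hx x' hx' => (Finset.mem_filter.1 hx).2.1.trans (Finset.mem_filter.1 hx').2.1.symm)
          (fun x hx x' hx' =>
            (Finset.mem_filter.1 hx).2.2.1.trans (Finset.mem_filter.1 hx').2.2.1.symm)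
          (fun x hx x' hx' =>
            (Finset.mem_filter.1 hx).2.2.2.trans (Finset.mem_filter.1 hx').2.2.2.symm)
      have hsub : B.filter (fun x : ℕ => (x : ℤ) ≡ a [ZMOD q]) ⊆ cls a ∪ cls d := by
        intro x hx
        rw [Finset.mem_filter] at hx
        have hxa : (x : ℤ) % q = (a : ℤ) % q := hx.2
        have := H x hx.1
        simp only [hcls, Finset.mem_union, Finset.mem_filter]
        grind
      have h10 := (Finset.card_le_card hsub).trans (Finset.card_union_le _ _)
      change residueCount B q a ≤ _ at h10
      rw [hconst] at h10
      have h11 := hcl a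
      have h12 := hcl d
      nlinarith

/-- The case in which the mask polynomial of `B` vanishes at all products of two of the three
primes. -/
lemma cyclotomic_mul_false {A B : Finset ℕ} {p q r n : ℕ} (hp : p.Prime)
    (hq : q.Prime) (hr : r.Prime) (hpq : p ≠ q) (hpr : p ≠ r) (hqr : q ≠ r)
    (hcop : (p ^ n * q).Coprime r) (hcard : #A = #B)
    (hB : InjMod (p ^ n * q * r) B) (hAB : DifferencesVanish p q r n A B)
    (hBpq : cyclotomic (p * q) ℤ ∣ maskPoly B) (hBpr : cyclotomic (p * r) ℤ ∣ maskPoly B)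
    (hBqr : cyclotomic (q * r) ℤ ∣ maskPoly B)
    (hneq : ∃ a ∈ B, ∃ b ∈ B, (a : ℤ) % q ≠ (b : ℤ) % q)
    (hner : ∃ a ∈ B, ∃ b ∈ B, (a : ℤ) % r ≠ (b : ℤ) % r)
    (hS : IsStar B (fun b => (b : ℤ) % p) (fun b => (b : ℤ) % q) (fun b => (b : ℤ) % r) ∨
      IsParity B (fun b => (b : ℤ) % p) (fun b => (b : ℤ) % q) (fun b => (b : ℤ) % r)) : False := by
  rcases hS with hS | ⟨a, ha, b, -, c, -, d, -, h1, h2, h3, h4, h5, h6, -, -, -, H⟩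
  · obtain ⟨c, hc⟩ := hS.exists_center hp hq hr hpq hpr hqr
    have hcop' : (p ^ n).Coprime q := ((Nat.coprime_primes hp hq).2 hpq).pow_left n
    have key : ∀ x ∈ B.filter (fun b : ℕ => (b : ℤ) ≡ c [ZMOD (q * r : ℕ)]),
        (x : ℤ) ≡ c [ZMOD q] ∧ (x : ℤ) ≡ c [ZMOD r] := fun x hx =>
      (modEq_natMul_iff ((Nat.coprime_primes hq hr).2 hqr)).1 (Finset.mem_filter.1 hx).2
    obtain ⟨k, hk1, hk2⟩ := exists_pow_dvd_card hp hcop hcop' hB hAB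
      (Finset.filter_subset (fun b : ℕ => (b : ℤ) ≡ c [ZMOD (q * r : ℕ)]) B)
      (fun x hx y hy => (key x hx).1.trans (key y hy).1.symm)
      (fun x hx y hy => (key x hx).2.trans (key y hy).2.symm)
    obtain ⟨s, hs, hs'⟩ := exists_mem_ne (f := fun b : ℕ => (b : ℤ) % q) hneq (c % q)
    obtain ⟨t, ht, ht'⟩ := exists_mem_ne (f := fun b : ℕ => (b : ℤ) % r) hner (c % r)
    exact star_false hp hq hr hpq hpr hqr hc hBpq hBpr hBqr ⟨s, hs, hs'⟩ ⟨t, ht, ht'⟩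
      ⟨k, hk1, hcard ▸ hk2⟩
  · simp only at h1 h2 h3 h4 h5 h6 H
    have hne : B.Nonempty := ⟨a, ha⟩
    have mp : 3 ≤ p → ∃ s : ℤ, ∀ b ∈ B, ¬ (b : ℤ) ≡ s [ZMOD p] := fun h =>
      exists_missing_residue (x := a) (y := b) h fun t ht => by
        have := H t ht
        exact (show (t : ℤ) % p = (a : ℤ) % p ∨ (t : ℤ) % p = (b : ℤ) % p by
          rw [← h1, ← h2] at this; tauto)
    have mq : 3 ≤ q → ∃ s : ℤ, ∀ b ∈ B, ¬ (b : ℤ) ≡ s [ZMOD q] := fun h =>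
      exists_missing_residue (x := a) (y := b) h fun t ht => by
        have := H t ht
        exact (show (t : ℤ) % q = (a : ℤ) % q ∨ (t : ℤ) % q = (b : ℤ) % q by
          rw [← h3, ← h4] at this; tauto)
    have mr : 3 ≤ r → ∃ s : ℤ, ∀ b ∈ B, ¬ (b : ℤ) ≡ s [ZMOD r] := fun h =>
      exists_missing_residue (x := a) (y := c) h fun t ht => by
        have := H t ht
        exact (show (t : ℤ) % r = (a : ℤ) % r ∨ (t : ℤ) % r = (c : ℤ) % r by
          rw [← h5, ← h6] at this; tauto)
    have hp2 := hp.two_le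
    have hq2 := hq.two_le
    have hr2 := hr.two_le
    by_cases hp3 : 3 ≤ p
    · by_cases hq3 : 3 ≤ q
      · exact not_cyclotomic_dvd_of_missing hp hq hpq hne (mp hp3) (mq hq3) hBpq
      · exact not_cyclotomic_dvd_of_missing hp hr hpr hne (mp hp3) (mr (by omega)) hBpr
    · exact not_cyclotomic_dvd_of_missing hq hr hqr hne (mq (by omega)) (mr (by omega)) hBqr

lemma injMod_of_not_cyclotomic_dvd {A B : Finset ℕ} {p q r n : ℕ} (hcop : (p ^ n * q).Coprime r)
    (hcop' : (p ^ n).Coprime q) (hA : InjMod (p ^ n * q * r) A)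
    (hBA : DifferencesVanish p q r n B A) (hBr : ¬ cyclotomic r ℤ ∣ maskPoly B) :
    InjMod (p ^ n * q) A := by
  intro a ha b hb hab
  by_contra hne
  have hab' := (modEq_natMul_iff hcop').1 hab
  have := hBA a ha b hb hne n le_rfl hab'.1 (Or.inl rfl)
  rw [if_pos hab'.2, if_neg fun h => hne (hA a ha b hb ((modEq_natMul_iff hcop).2 ⟨hab, h⟩))] at this
  simp only [Nat.sub_self, pow_zero, one_mul] at this
  exact hBr this

/-- A pair of elements of `B` congruent modulo `r` but not modulo `p` or `q` makes the mask
polynomial of `A` vanish at order `p ^ n * q`. -/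
lemma cyclotomic_dvd_of_agree_only {A B : Finset ℕ} {p q r n : ℕ}
    (hAB : DifferencesVanish p q r n A B) {a b : ℕ} (ha : a ∈ B) (hb : b ∈ B)
    (h1 : ¬ (a : ℤ) ≡ b [ZMOD p]) (h2 : ¬ (a : ℤ) ≡ b [ZMOD q]) (h3 : (a : ℤ) ≡ b [ZMOD r]) :
    cyclotomic (p ^ n * q) ℤ ∣ maskPoly A := by
  have := hAB a ha b hb (by rintro rfl; exact h1 rfl) 0 n.zero_le
    (by simpa using Int.modEq_one) (Or.inr (by simpa using h1))
  rwa [if_neg h2, if_pos h3, Nat.sub_zero, mul_one] at this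

/-- If the differences of `A` and of `B` vanish on each other, `A` is not a union of fibers in the
`p` direction and `B` is not equidistributed modulo both `q` and `r`, then the mask polynomial of
`A` vanishes at the primitive roots of unity of order `p ^ (e + 1) * q * r`. -/
theorem cyclotomic_dvd_maskPoly {A B : Finset ℕ} {p q r e : ℕ} (hp : p.Prime)
    (hq : q.Prime) (hr : r.Prime) (hpq : p ≠ q) (hpr : p ≠ r) (hqr : q ≠ r) (hcard : #A = #B)
    (hA : InjMod (p ^ (e + 1) * q * r) A) (hB : InjMod (p ^ (e + 1) * q * r) B)
    (hAB : DifferencesVanish p q r (e + 1) A B) (hBA : DifferencesVanish p q r (e + 1) B A)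
    (hBp : ∃ a ∈ B, ∃ b ∈ B, (a : ℤ) % p ≠ (b : ℤ) % p)
    (hBq : ∃ a ∈ B, ∃ b ∈ B, (a : ℤ) % q ≠ (b : ℤ) % q)
    (hBr : ∃ a ∈ B, ∃ b ∈ B, (a : ℤ) % r ≠ (b : ℤ) % r)
    (hAu : ∃ a ∈ A, ∃ k : ℤ, k ≡ a [ZMOD (p ^ e * q * r : ℕ)] ∧
      ∀ a' ∈ A, ¬ (a' : ℤ) ≡ k [ZMOD (p ^ (e + 1) * q * r : ℕ)])
    (hqB : ¬ (cyclotomic r ℤ ∣ maskPoly B ∧ cyclotomic q ℤ ∣ maskPoly B)) :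
    cyclotomic (p ^ (e + 1) * q * r) ℤ ∣ maskPoly A := by
  by_contra hN
  wlog hrB : ¬ cyclotomic r ℤ ∣ maskPoly B generalizing q r
  · refine this hr hq hpr hpq hqr.symm ?_ ?_ hAB.swap hBA.swap hBr hBq ?_
      (fun h => hqB ⟨h.2, h.1⟩) ?_ (fun h => hqB ⟨not_not.1 hrB, h⟩)
    · rwa [mul_right_comm]
    · rwa [mul_right_comm]
    · simpa only [mul_right_comm _ r q] using hAu
    · rwa [mul_right_comm]
  have cpq : (p ^ (e + 1)).Coprime q := ((Nat.coprime_primes hp hq).2 hpq).pow_left _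
  have cpr : (p ^ (e + 1)).Coprime r := ((Nat.coprime_primes hp hr).2 hpr).pow_left _
  have cqr : q.Coprime r := (Nat.coprime_primes hq hr).2 hqr
  have cr : (p ^ (e + 1) * q).Coprime r := cpr.mul_left cqr
  have cq : (p ^ (e + 1) * r).Coprime q := cpq.mul_left cqr.symm
  have hpair : ∀ a ∈ B, ∀ b ∈ B, (a : ℤ) % p = (b : ℤ) % p ∨ (a : ℤ) % q = (b : ℤ) % q ∨
      (a : ℤ) % r = (b : ℤ) % r := by
    intro a ha b hb
    by_contra! h
    change ¬ (a : ℤ) ≡ b [ZMOD p] ∧ ¬ (a : ℤ) ≡ b [ZMOD q] ∧ ¬ (a : ℤ) ≡ b [ZMOD r] at h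
    have := hAB a ha b hb (by rintro rfl; exact h.1 rfl) 0 (Nat.zero_le _)
      (by simpa using Int.modEq_one) (Or.inr (by simpa using h.1))
    rw [if_neg h.2.1, if_neg h.2.2] at this
    exact hN this
  have hS := isStar_or_isParity hpair hBp hBq hBr
  have hAq : cyclotomic (p ^ (e + 1) * q) ℤ ∣ maskPoly A := by
    obtain ⟨a, ha, b, hb, h1, h2, h3⟩ := exists_agree_only hS hBp hBq
    exact cyclotomic_dvd_of_agree_only hAB ha hb h1 h2 h3
  have hAr : cyclotomic (p ^ (e + 1) * r) ℤ ∣ maskPoly A := by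
    obtain ⟨a, ha, b, hb, h1, h2, h3⟩ :=
      exists_agree_only (hS.imp (·.rotate.rotate) (·.rotate.rotate)) hBr hBp
    exact cyclotomic_dvd_of_agree_only hAB.swap ha hb h2 h1 h3
  have hinjq := injMod_of_not_cyclotomic_dvd cr cpq hA hBA hrB
  by_cases hqB' : cyclotomic q ℤ ∣ maskPoly B
  · obtain ⟨a, ha, b, hb, hab⟩ := hBq
    exact equidistributed_false hp e.succ_pos hq hpq cr hcard hB hAB
      (cyclotomic_prime_pow_dvd_of_injMod hp hq hr hpq hpr hqr hinjq hAq hAr) hqB'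
      ⟨a, ha, b, hb, hab.symm⟩ hS
  · have hinjr := injMod_of_not_cyclotomic_dvd cq cpr (by rwa [mul_right_comm]) hBA.swap hqB'
    obtain ⟨h1, h2, h3⟩ :=
      cyclotomic_mul_dvd_of_not_union hp hq hr hpq hpr hqr hinjq hinjr hAq hAr hBA hAu
    exact cyclotomic_mul_false hp hq hr hpq hpr hqr cr hcard hB hAB h1 h2 h3 hBq hBr hS

lemma chi_eq_sum {N : ℕ} [NeZero N] (A : Finset (ZMod N)) (b : ZMod N) :
    chi N A b = ∑ a ∈ A, ZMod.stdAddChar (a * b) :=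
  Finset.sum_congr rfl fun a _ => by rw [ZMod.stdAddChar_apply, ZMod.toCircle_apply]

lemma isPrimitiveRoot_stdAddChar {N : ℕ} [NeZero N] (b : ZMod N) :
    IsPrimitiveRoot (ZMod.stdAddChar b : ℂ) (addOrderOf b) := by
  rw [IsPrimitiveRoot.iff_orderOf, ← orderOf_ofAdd_eq_addOrderOf]
  exact orderOf_injective (ZMod.stdAddChar (N := N)).toMonoidHom
    (fun x y h => ZMod.injective_stdAddChar h) _

lemma chi_eq_zero_iff {N : ℕ} [NeZero N] (A : Finset (ZMod N)) (b : ZMod N) :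
    chi N A b = 0 ↔ cyclotomic (addOrderOf b) ℤ ∣ maskPoly (A.image ZMod.val) := by
  rw [cyclotomic_dvd_maskPoly_iff (addOrderOf_pos b) (isPrimitiveRoot_stdAddChar b),
    Finset.sum_image fun x _ y _ h => ZMod.val_injective N h, chi_eq_sum]
  simp only [← AddChar.map_nsmul_eq_pow, nsmul_eq_mul, ZMod.natCast_zmod_val]

/-- The spectral pair relation is symmetric. -/
lemma isSpectralPair_symm {N : ℕ} [NeZero N] {A B : Finset (ZMod N)}
    (h : IsSpectralPair N A B) (hA : A.Nonempty) : IsSpectralPair N B A := by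
  obtain ⟨hcard, h⟩ := h
  have hm : (#A : ℂ) ≠ 0 := by exact_mod_cast hA.card_pos.ne'
  let L : Matrix B A ℂ := fun b a => (#A : ℂ)⁻¹ * ZMod.stdAddChar ((a : ZMod N) * (b : ZMod N))
  let R : Matrix A B ℂ := fun a b => ZMod.stdAddChar (-((a : ZMod N) * (b : ZMod N)))
  have hLR : L * R = 1 := by
    ext b b'
    have h1 : (L * R) b b' = (#A : ℂ)⁻¹ * chi N A (b - b') := by
      rw [chi_eq_sum, ← Finset.sum_coe_sort, Finset.mul_sum, Matrix.mul_apply]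
      refine Finset.sum_congr rfl fun a _ => ?_
      rw [mul_assoc, ← AddChar.map_add_eq_mul]
      congr 2; ring
    rw [h1, Matrix.one_apply]
    split_ifs with hb
    · subst hb
      simp [chi_eq_sum, hm]
    · rw [h b b.2 b' b'.2 fun h' => hb (Subtype.ext h'), mul_zero]
  have hRL : R * L = 1 :=
    (Matrix.mul_eq_one_comm_of_card_eq _ _ _ (by simpa using hcard.symm)).1 hLR
  refine ⟨hcard.symm, fun a ha a' ha' hne => ?_⟩
  have h2 := congrFun (congrFun hRL ⟨a', ha'⟩) ⟨a, ha⟩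
  rw [Matrix.one_apply_ne (by simpa using hne.symm), Matrix.mul_apply] at h2
  rw [chi_eq_sum, ← Finset.sum_coe_sort]
  refine (mul_eq_zero.1 (?_ : (#A : ℂ)⁻¹ * _ = 0)).resolve_left (inv_ne_zero hm)
  rw [← h2, Finset.mul_sum]
  refine Finset.sum_congr rfl fun b _ => ?_
  rw [mul_left_comm, ← AddChar.map_add_eq_mul]
  congr 2; ring

lemma chi_one_eq_zero_of_isUnionOfCosets {N p M : ℕ} [NeZero N] (hN : N = p * M) (hp : 1 < p)
    {B : Finset (ZMod N)} (hB : IsUnionOfCosets N p B) : chi N B 1 = 0 := by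
  have hM : (M : ZMod N) ≠ 0 := fun h => by
    have h0 : 0 < M := Nat.pos_of_ne_zero fun h => NeZero.ne N (by rw [hN, h, mul_zero])
    have := Nat.le_of_dvd h0 ((ZMod.natCast_eq_zero_iff _ _).1 h)
    nlinarith
  have hshift : B.map (addRightEmbedding (M : ZMod N)) = B := by
    refine Finset.eq_of_subset_of_card_le (fun x hx => ?_) (by rw [Finset.card_map])
    obtain ⟨b, hb, rfl⟩ := Finset.mem_map.1 hx
    refine hB b hb M ?_
    rw [← Nat.cast_mul, ← hN, ZMod.natCast_self]
  have h1 : chi N B 1 = chi N B 1 * ZMod.stdAddChar (M : ZMod N) := by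
    simp only [chi_eq_sum, mul_one]
    conv_lhs => rw [← hshift]
    rw [Finset.sum_map, Finset.sum_mul]
    exact Finset.sum_congr rfl fun b _ => AddChar.map_add_eq_mul _ _ _
  refine (mul_eq_zero.1 (?_ : chi N B 1 * (1 - ZMod.stdAddChar (M : ZMod N)) = 0)).resolve_right ?_
  · linear_combination h1
  · intro h
    exact hM (ZMod.injective_stdAddChar (by rw [AddChar.map_zero_eq_one]; linear_combination -h))

lemma dvd_val_sub_iff {N d : ℕ} [NeZero N] (hd : d ∣ N) (b b' : ZMod N) :
    d ∣ (b - b').val ↔ (b.val : ℤ) ≡ b'.val [ZMOD d] := by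
  have h : ((b - b').val : ℤ) ≡ b.val - b'.val [ZMOD N] := by
    rw [← ZMod.intCast_eq_intCast_iff]
    simp
  have hd' : ((b - b').val : ℤ) ≡ b.val - b'.val [ZMOD d] := h.of_dvd (by exact_mod_cast hd)
  rw [← Int.natCast_dvd_natCast, Int.modEq_comm, Int.modEq_iff_dvd]
  exact ⟨fun h1 => Int.modEq_zero_iff_dvd.1 (hd'.symm.trans (Int.modEq_zero_iff_dvd.2 h1)),
    fun h1 => Int.modEq_zero_iff_dvd.1 (hd'.trans (Int.modEq_zero_iff_dvd.2 h1))⟩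

lemma addOrderOf_natCast {p q r n z j : ℕ} (hp : p.Prime) (hq : q.Prime) (hr : r.Prime)
    (hpq : p ≠ q) (hpr : p ≠ r) (hqr : q ≠ r) (hj : j ≤ n) (h1 : p ^ j ∣ z)
    (h2 : j = n ∨ ¬ p ^ (j + 1) ∣ z) :
    addOrderOf (z : ZMod (p ^ n * q * r)) =
      p ^ (n - j) * (if q ∣ z then 1 else q) * (if r ∣ z then 1 else r) := by
  have hpos : 0 < p ^ n * q * r := Nat.mul_pos (Nat.mul_pos (pow_pos hp.pos n) hq.pos) hr.pos
  have hprime : ∀ {q : ℕ}, q.Prime → z.gcd q * (if q ∣ z then 1 else q) = q := fun {q} hq => by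
    split_ifs with h
    · rw [Nat.gcd_eq_right h, mul_one]
    · rw [((Nat.Prime.coprime_iff_not_dvd hq).2 h).symm.gcd_eq_one, one_mul]
  have hpow : z.gcd (p ^ n) = p ^ j := by
    obtain ⟨i, hi, hi'⟩ := (Nat.dvd_prime_pow hp).1 (Nat.gcd_dvd_right z (p ^ n))
    have hji : j ≤ i := by
      rw [← Nat.pow_dvd_pow_iff_le_right hp.one_lt, ← hi']
      exact Nat.dvd_gcd h1 (pow_dvd_pow p hj)
    rcases hji.eq_or_lt with rfl | hlt
    · exact hi'
    · refine absurd ((pow_dvd_pow p hlt).trans (hi' ▸ Nat.gcd_dvd_left z (p ^ n))) ?_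
      exact h2.resolve_left (by omega)
  have hg : z.gcd (p ^ n * q * r) = p ^ j * z.gcd q * z.gcd r := by
    rw [Nat.Coprime.gcd_mul, Nat.Coprime.gcd_mul, hpow]
    · exact ((Nat.coprime_primes hp hq).2 hpq).pow_left n
    · exact (((Nat.coprime_primes hp hr).2 hpr).pow_left n).mul_left
        ((Nat.coprime_primes hq hr).2 hqr)
  rw [ZMod.addOrderOf_coe _ hpos.ne', Nat.gcd_comm]
  refine Nat.div_eq_of_eq_mul_right (Nat.gcd_pos_of_pos_right _ hpos) ?_
  rw [hg]
  conv_lhs => rw [← hprime hq, ← hprime hr, ← Nat.add_sub_cancel' hj, pow_add]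
  ring

lemma differencesVanish_image {p q r n : ℕ} (hp : p.Prime) (hq : q.Prime) (hr : r.Prime)
    (hpq : p ≠ q) (hpr : p ≠ r) (hqr : q ≠ r) [NeZero (p ^ n * q * r)]
    {A B : Finset (ZMod (p ^ n * q * r))} (h : IsSpectralPair (p ^ n * q * r) A B) :
    DifferencesVanish p q r n (A.image ZMod.val) (B.image ZMod.val) := by
  intro x hx x' hx' hne j hj h1 h2
  obtain ⟨b, hb, rfl⟩ := Finset.mem_image.1 hx
  obtain ⟨b', hb', rfl⟩ := Finset.mem_image.1 hx'
  have h3 := (chi_eq_zero_iff A (b - b')).1 (h.2 b hb b' hb' fun h => hne (by rw [h]))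
  have hdvd : ∀ i ≤ n, p ^ i ∣ p ^ n * q * r := fun i hi =>
    ((pow_dvd_pow p hi).mul_right q).mul_right r
  rw [← ZMod.natCast_zmod_val (b - b'), addOrderOf_natCast (j := j) hp hq hr hpq hpr hqr hj
    ((dvd_val_sub_iff (hdvd j hj) b b').2 h1)
    (hj.eq_or_lt.imp_right fun hlt h4 =>
      h2.resolve_left (Nat.ne_of_lt hlt) ((dvd_val_sub_iff (hdvd (j + 1) hlt) b b').1 h4))] at h3
  simpa only [dvd_val_sub_iff ((dvd_mul_left q (p ^ n)).mul_right r),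
      dvd_val_sub_iff (dvd_mul_left r (p ^ n * q))] using h3

lemma exists_val_mod_ne {N ℓ : ℕ} [NeZero N] (hℓ : ℓ.Prime) (hN : ℓ ∣ N) {B : Finset (ZMod N)}
    (h0 : (0 : ZMod N) ∈ B) (hB : AddSubgroup.closure (B : Set (ZMod N)) = ⊤) :
    ∃ a ∈ B.image ZMod.val, ∃ b ∈ B.image ZMod.val, (a : ℤ) % ℓ ≠ (b : ℤ) % ℓ := by
  by_contra! h
  let φ := (ZMod.castHom hN (ZMod ℓ)).toAddMonoidHom
  have hle : AddSubgroup.closure (B : Set (ZMod N)) ≤ φ.ker := by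
    rw [AddSubgroup.closure_le]
    intro b hb
    have h1 := h b.val (Finset.mem_image_of_mem _ hb) _ (Finset.mem_image_of_mem _ h0)
    rw [ZMod.val_zero, Nat.cast_zero, Int.zero_emod] at h1
    have h2 : ((b.val : ℕ) : ZMod ℓ) = 0 := by
      rw [ZMod.natCast_eq_zero_iff]
      exact_mod_cast Int.dvd_of_emod_eq_zero h1
    have h3 : φ b = 0 := by
      rw [← h2, ← ZMod.natCast_zmod_val b]
      simp [φ]
    exact h3
  rw [hB] at hle
  have h1 : ZMod.castHom hN (ZMod ℓ) 1 = 0 := hle (AddSubgroup.mem_top 1)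
  have := Fact.mk hℓ
  rw [map_one] at h1
  exact one_ne_zero h1

lemma injMod_image {N : ℕ} [NeZero N] (A : Finset (ZMod N)) : InjMod N (A.image ZMod.val) := by
  intro a ha b hb h
  obtain ⟨x, -, rfl⟩ := Finset.mem_image.1 ha
  obtain ⟨y, -, rfl⟩ := Finset.mem_image.1 hb
  rw [← ZMod.intCast_eq_intCast_iff] at h
  simpa using congrArg ZMod.val h

lemma exists_of_not_isUnionOfCosets {N p M : ℕ} [NeZero N] (hN : N = p * M) (hp : 0 < p)
    {A : Finset (ZMod N)} (hA : ¬ IsUnionOfCosets N p A) :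
    ∃ a ∈ A.image ZMod.val, ∃ k : ℤ, k ≡ a [ZMOD M] ∧
      ∀ a' ∈ A.image ZMod.val, ¬ (a' : ℤ) ≡ k [ZMOD N] := by
  simp only [IsUnionOfCosets, not_forall] at hA
  obtain ⟨a, ha, x, hx, hax⟩ := hA
  refine ⟨a.val, Finset.mem_image_of_mem _ ha, a.val + x.val, ?_, ?_⟩
  · have h1 : N ∣ p * x.val := by
      rw [← ZMod.natCast_eq_zero_iff, Nat.cast_mul, ZMod.natCast_zmod_val, hx]
    have h2 : (M : ℤ) ∣ x.val := by
      exact_mod_cast Nat.dvd_of_mul_dvd_mul_left hp (hN.symm.dvd.trans h1)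
    simpa using ((Int.modEq_zero_iff_dvd.2 h2).add_left (a.val : ℤ))
  · intro a' ha' h
    obtain ⟨y, hy, rfl⟩ := Finset.mem_image.1 ha'
    rw [← ZMod.intCast_eq_intCast_iff] at h
    simp only [Int.cast_natCast, Int.cast_add, ZMod.natCast_zmod_val] at h
    exact hax (h ▸ hy)

lemma chi_one_eq_zero {p q r n : ℕ} (hp : p.Prime) (hq : q.Prime) (hr : r.Prime)
    (hpq : p ≠ q) (hpr : p ≠ r) (hqr : q ≠ r) (hn : 0 < n) [NeZero (p ^ n * q * r)]
    {A B : Finset (ZMod (p ^ n * q * r))} (hAB : IsSpectralPair (p ^ n * q * r) A B)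
    (hBA : IsSpectralPair (p ^ n * q * r) B A)
    (h0 : (0 : ZMod (p ^ n * q * r)) ∈ B)
    (hgen : AddSubgroup.closure (B : Set (ZMod (p ^ n * q * r))) = ⊤)
    (hB : ¬ (chi (p ^ n * q * r) B ((p ^ n * q : ℕ) : ZMod (p ^ n * q * r)) = 0 ∧
      chi (p ^ n * q * r) B ((p ^ n * r : ℕ) : ZMod (p ^ n * q * r)) = 0)) :
    chi (p ^ n * q * r) A 1 = 0 := by
  obtain ⟨e, rfl⟩ : ∃ e, n = e + 1 := ⟨n - 1, by omega⟩
  have hNp : p ^ (e + 1) * q * r = p * (p ^ e * q * r) := by ring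
  by_cases hA : IsUnionOfCosets (p ^ (e + 1) * q * r) p A
  · exact chi_one_eq_zero_of_isUnionOfCosets hNp hp.one_lt hA
  have hpn : p ^ (e + 1) * q * r ≠ 0 := NeZero.ne _
  have hcq : ¬ q ∣ p ^ (e + 1) * r := fun h => by
    rcases hq.dvd_mul.1 h with h | h
    · exact hpq ((Nat.prime_dvd_prime_iff_eq hq hp).1 (hq.dvd_of_dvd_pow h)).symm
    · exact hqr ((Nat.prime_dvd_prime_iff_eq hq hr).1 h)
  have hcr : ¬ r ∣ p ^ (e + 1) * q := fun h => by
    rcases hr.dvd_mul.1 h with h | h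
    · exact hpr ((Nat.prime_dvd_prime_iff_eq hr hp).1 (hr.dvd_of_dvd_pow h)).symm
    · exact hqr ((Nat.prime_dvd_prime_iff_eq hr hq).1 h).symm
  rw [chi_eq_zero_iff, chi_eq_zero_iff,
    addOrderOf_natCast hp hq hr hpq hpr hqr le_rfl (dvd_mul_right _ _) (Or.inl rfl),
    addOrderOf_natCast hp hq hr hpq hpr hqr le_rfl (dvd_mul_right _ _) (Or.inl rfl),
    if_pos (dvd_mul_left q _), if_neg hcr, if_pos (dvd_mul_left r _), if_neg hcq] at hB
  simp only [Nat.sub_self, pow_zero, one_mul, mul_one] at hB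
  have hone := ZMod.addOrderOf_coe 1 hpn
  rw [Nat.cast_one, Nat.gcd_one_right, Nat.div_one] at hone
  rw [chi_eq_zero_iff, hone]
  have hval : Function.Injective (ZMod.val : ZMod (p ^ (e + 1) * q * r) → ℕ) := ZMod.val_injective _
  refine cyclotomic_dvd_maskPoly hp hq hr hpq hpr hqr ?_ (injMod_image A) (injMod_image B)
    (differencesVanish_image hp hq hr hpq hpr hqr hAB)
    (differencesVanish_image hp hq hr hpq hpr hqr hBA)
    (exists_val_mod_ne hp ⟨_, hNp⟩ h0 hgen)
    (exists_val_mod_ne hq ((dvd_mul_left q _).mul_right r) h0 hgen)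
    (exists_val_mod_ne hr (dvd_mul_left r _) h0 hgen)
    (exists_of_not_isUnionOfCosets hNp hp.pos hA) hB
  rw [Finset.card_image_of_injective _ hval, Finset.card_image_of_injective _ hval, hAB.1]

end SpectralPair

theorem one_in_zero_set (p q r n : ℕ) (hp : p.Prime) (hq : q.Prime) (hr : r.Prime)
    (hpq : p ≠ q) (hpr : p ≠ r) (hqr : q ≠ r) (hn : 0 < n)
    (N : ℕ) (hN : N = p ^ n * q * r)
    (A B : Finset (ZMod N)) (hAB : IsSpectralPair N A B)
    (hA1 : 1 < A.card) (hA2 : A.card < N)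
    (h0A : (0 : ZMod N) ∈ A) (h0B : (0 : ZMod N) ∈ B)
    (hgenA : AddSubgroup.closure (A : Set (ZMod N)) = ⊤)
    (hgenB : AddSubgroup.closure (B : Set (ZMod N)) = ⊤)
    (hcosP : ¬ IsUnionOfCosets N p A) (hcosQ : ¬ IsUnionOfCosets N q A)
    (hcosR : ¬ IsUnionOfCosets N r A)
    (hnotile : ¬ Tiles N A) :
    (¬ (chi N B ((p ^ n * q : ℕ) : ZMod N) = 0 ∧ chi N B ((p ^ n * r : ℕ) : ZMod N) = 0) →
        chi N A (1 : ZMod N) = 0) ∧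
    (¬ (chi N A ((p ^ n * q : ℕ) : ZMod N) = 0 ∧ chi N A ((p ^ n * r : ℕ) : ZMod N) = 0) →
        chi N B (1 : ZMod N) = 0) := by
  subst hN
  have : NeZero (p ^ n * q * r) :=
    ⟨(Nat.mul_pos (Nat.mul_pos (pow_pos hp.pos n) hq.pos) hr.pos).ne'⟩
  have hBA := SpectralPair.isSpectralPair_symm hAB ⟨0, h0A⟩
  exact ⟨SpectralPair.chi_one_eq_zero hp hq hr hpq hpr hqr hn hAB hBA h0B hgenB,
    SpectralPair.chi_one_eq_zero hp hq hr hpq hpr hqr hn hBA hAB h0A hgenA⟩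
end
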